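/- arXiv:1806.02219 — 5 statements merged into one kernel-verified Lean document; each statement's English description precedes it below -/
import Mathlib

section
/- Let H∈(0,1/2], q≥1 and 0≤s<t. Define g:[0,s]→ℝ by g(u) := R_H(t,u)−R_H(s,u). Then for every finite partition 0=r_0<r_1<…<r_n=s of [0,s], (Σ_{i=0}^{n−1} |g(r_{i+1})−g(r_i)|^q)^{1/q} ≤ |t−s|^{2H}; that is, ||R_H(t,·)−R_H(s,·)||_{q-var;[0,s]} ≤ |t−s|^{2H}. -/
/-- The covariance function of standard fractional Brownian motion with Hurst parameter `H`. -/
noncomputable def fbmCov (H s t : ℝ) : ℝ :=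
  (s ^ (2 * H) + t ^ (2 * H) - |t - s| ^ (2 * H)) / 2

theorem sum_rpow_le_rpow_sum_of_nonneg {ι : Type*} (s : Finset ι) (f : ι → ℝ)
    (hf : ∀ i ∈ s, 0 ≤ f i) {q : ℝ} (hq : 1 ≤ q) :
    ∑ i ∈ s, f i ^ q ≤ (∑ i ∈ s, f i) ^ q := by
  classical
  induction s using Finset.induction_on with
  | empty => simp [Real.zero_rpow (by linarith : q ≠ 0)]
  | insert a s ha ih =>
    rw [Finset.sum_insert ha, Finset.sum_insert ha]
    have hs : ∀ i ∈ s, 0 ≤ f i := fun i hi => hf i (Finset.mem_insert_of_mem hi)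
    have h := Real.add_rpow_le_rpow_add (hf a (Finset.mem_insert_self a s))
      (Finset.sum_nonneg hs) hq
    linarith [ih hs]

theorem add_rpow_sub_rpow_le_of_le {a x y h : ℝ} (ha0 : 0 ≤ a) (ha1 : a ≤ 1) (hx : 0 ≤ x)
    (hxy : x ≤ y) (hh : 0 < h) : (y + h) ^ a - y ^ a ≤ (x + h) ^ a - x ^ a := by
  have hd : 0 < y - x + h := by linarith
  have hw : 0 ≤ h / (y - x + h) := by positivity
  have hw' : 0 ≤ (y - x) / (y - x + h) := div_nonneg (by linarith) hd.le
  have hsum : (y - x) / (y - x + h) + h / (y - x + h) = 1 := by field_simp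
  have hx' : x ∈ Set.Ici (0 : ℝ) := hx
  have hy' : y + h ∈ Set.Ici (0 : ℝ) := by simp only [Set.mem_Ici]; linarith
  have h1 := (Real.concaveOn_rpow ha0 ha1).2 hx' hy' hw' hw hsum
  have h2 := (Real.concaveOn_rpow ha0 ha1).2 hx' hy' hw hw' (by rw [add_comm]; exact hsum)
  simp only [smul_eq_mul] at h1 h2
  have e1 : (y - x) / (y - x + h) * x + h / (y - x + h) * (y + h) = x + h := by
    field_simp; ring
  have e2 : h / (y - x + h) * x + (y - x) / (y - x + h) * (y + h) = y := by
    field_simp; ring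
  rw [e1] at h1
  rw [e2] at h2
  have e3 : (y - x) / (y - x + h) = 1 - h / (y - x + h) := by linarith
  rw [e3] at h1 h2
  linarith

theorem fbmCov_sub_antitoneOn {H s t : ℝ} (hH0 : 0 < H) (hH : H ≤ 1 / 2) (hst : s < t) :
    AntitoneOn (fun u => fbmCov H t u - fbmCov H s u) (Set.Iic s) := by
  intro u hu v hv huv
  simp only [Set.mem_Iic] at hu hv
  have h := add_rpow_sub_rpow_le_of_le (a := 2 * H) (x := s - v) (y := s - u) (h := t - s)
    (by linarith) (by linarith) (by linarith) (by linarith) (by linarith)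
  rw [show s - u + (t - s) = t - u by ring, show s - v + (t - s) = t - v by ring] at h
  simp only [fbmCov]
  rw [abs_sub_comm u t, abs_sub_comm u s, abs_sub_comm v t, abs_sub_comm v s,
    abs_of_nonneg (by linarith : 0 ≤ t - u), abs_of_nonneg (by linarith : 0 ≤ s - u),
    abs_of_nonneg (by linarith : 0 ≤ t - v), abs_of_nonneg (by linarith : 0 ≤ s - v)]
  linarith

/-- For `H ∈ (0,1/2]`, `q ≥ 1` and `0 ≤ s < t`, every partition sum for the `q`-variation of
`u ↦ R_H(t,u) − R_H(s,u)` over `[0,s]` is bounded by `|t − s|^{2H}`. -/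
theorem fbm_increment_qvar_on_initial_interval
    (H q s t : ℝ) (hH0 : 0 < H) (hH : H ≤ 1 / 2) (hq : 1 ≤ q)
    (hs : 0 ≤ s) (hst : s < t)
    (n : ℕ) (r : ℕ → ℝ) (hmono : Monotone r) (hr0 : r 0 = 0)
    (hrn : ∀ m, n ≤ m → r m = s) :
    (∑ i ∈ Finset.range n,
        |(fbmCov H t (r (i + 1)) - fbmCov H s (r (i + 1)))
          - (fbmCov H t (r i) - fbmCov H s (r i))| ^ q) ^ (1 / q)
      ≤ |t - s| ^ (2 * H) := by
  have hrs : ∀ i, r i ≤ s := fun i =>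
    (hmono (le_max_left i n)).trans (hrn _ (le_max_right i n)).le
  have hsum : ∑ i ∈ Finset.range n,
      |(fbmCov H t (r (i + 1)) - fbmCov H s (r (i + 1)))
        - (fbmCov H t (r i) - fbmCov H s (r i))|
      = (fbmCov H t 0 - fbmCov H s 0) - (fbmCov H t s - fbmCov H s s) := by
    rw [← hr0, ← hrn n le_rfl,
      ← Finset.sum_range_sub' (fun i => fbmCov H t (r i) - fbmCov H (r n) (r i)), hrn n le_rfl]
    refine Finset.sum_congr rfl fun i _ => ?_
    have h := fbmCov_sub_antitoneOn hH0 hH hst (hrs i) (hrs (i + 1)) (hmono i.le_succ)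
    rw [abs_sub_comm]
    exact abs_of_nonneg (sub_nonneg.2 h)
  have hbound : (fbmCov H t 0 - fbmCov H s 0) - (fbmCov H t s - fbmCov H s s)
      ≤ |t - s| ^ (2 * H) := by
    have h0 : (0 : ℝ) ^ (2 * H) = 0 := Real.zero_rpow (by linarith)
    have h1 : s ^ (2 * H) ≤ t ^ (2 * H) := Real.rpow_le_rpow hs hst.le (by linarith)
    have h2 : 0 ≤ |t - s| ^ (2 * H) := by positivity
    simp only [fbmCov, zero_sub, abs_neg, sub_self, abs_zero, h0, abs_of_nonneg hs,
      abs_of_nonneg (hs.trans hst.le), abs_sub_comm s t]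
    linarith
  rw [← hsum] at hbound
  refine le_trans ?_ hbound
  rw [one_div, Real.rpow_inv_le_iff_of_pos (by positivity) (by positivity) (by linarith)]
  exact sum_rpow_le_rpow_sum_of_nonneg _ _ (fun i _ => abs_nonneg _) hq
end

section
/- Let T>0, H∈(1/4,1/2], and set q := 2/(1+2H). Then there exists a constant C<∞ such that for all 0≤s<t≤T, the one-parameter function u ↦ R_H(t,u)−R_H(s,u) satisfies ||R_H(t,·)−R_H(s,·)||_{q-var;[0,T]} ≤ C|t−s|^{2H}. -/
/-- The increments of `x ↦ x ^ a` over steps of fixed length decrease when `0 ≤ a ≤ 1`. -/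
theorem rpow_add_rpow_add_le {a v w h : ℝ} (ha0 : 0 ≤ a) (ha1 : a ≤ 1) (hv : 0 ≤ v)
    (hvw : v ≤ w) (hh : 0 < h) : v ^ a + (w + h) ^ a ≤ w ^ a + (v + h) ^ a := by
  have hc := Real.concaveOn_rpow ha0 ha1
  have hd : 0 < w - v + h := by linarith
  have hl : 0 ≤ h / (w - v + h) := by positivity
  have hm : 0 ≤ (w - v) / (w - v + h) := div_nonneg (by linarith) hd.le
  have hs : h / (w - v + h) + (w - v) / (w - v + h) = 1 := by
    field_simp
    ring
  have h1 := hc.2 (Set.mem_Ici.2 hv) (Set.mem_Ici.2 (by linarith : 0 ≤ w + h)) hl hm hs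
  have h2 := hc.2 (Set.mem_Ici.2 hv) (Set.mem_Ici.2 (by linarith : 0 ≤ w + h)) hm hl
    (by rw [add_comm]; exact hs)
  simp only [smul_eq_mul] at h1 h2
  have e1 : h / (w - v + h) * v + (w - v) / (w - v + h) * (w + h) = w := by
    field_simp
    ring
  have e2 : (w - v) / (w - v + h) * v + h / (w - v + h) * (w + h) = v + h := by
    field_simp
    ring
  rw [e1] at h1
  rw [e2] at h2
  have h3 : v ^ a + (w + h) ^ a
      = (h / (w - v + h) + (w - v) / (w - v + h)) * (v ^ a + (w + h) ^ a) := by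
    rw [hs, one_mul]
  rw [h3]
  linarith

theorem abs_rpow_le_add_abs_sub_rpow {a : ℝ} (ha0 : 0 ≤ a) (ha1 : a ≤ 1) (x y : ℝ) :
    |x| ^ a ≤ |y| ^ a + |x - y| ^ a := by
  have h : |x| ≤ |y| + |x - y| := by
    have := abs_add_le y (x - y)
    rwa [add_sub_cancel] at this
  exact (Real.rpow_le_rpow (abs_nonneg x) h ha0).trans
    (Real.rpow_add_le_add_rpow (abs_nonneg y) (abs_nonneg _) ha0 ha1)

theorem abs_abs_rpow_sub_abs_rpow_le {a : ℝ} (ha0 : 0 ≤ a) (ha1 : a ≤ 1) (x y : ℝ) :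
    |(|x| ^ a - |y| ^ a)| ≤ |x - y| ^ a := by
  have h1 := abs_rpow_le_add_abs_sub_rpow ha0 ha1 x y
  have h2 := abs_rpow_le_add_abs_sub_rpow ha0 ha1 y x
  rw [abs_sub_comm y x] at h2
  exact abs_le.2 ⟨by linarith, by linarith⟩

/-- A function that is decreasing, then increasing, then decreasing has total variation at most
six times its sup norm. -/
theorem sum_abs_sub_le_of_piecewise_monotone {g : ℝ → ℝ} {s t M : ℝ} (hst : s ≤ t)
    (h1 : AntitoneOn g (Set.Iic s)) (h2 : MonotoneOn g (Set.Icc s t))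
    (h3 : AntitoneOn g (Set.Ici t)) (hM : ∀ u, |g u| ≤ M) {r : ℕ → ℝ} (hr : Monotone r) (n : ℕ) :
    ∑ i ∈ Finset.range n, |g (r (i + 1)) - g (r i)| ≤ 6 * M := by
  set G : ℝ → ℝ := fun u => g (max s (min u t)) - g (min u s) - g (max u t) with hG
  have hdecomp : ∀ u, g u = g (max s (min u t)) + g (min u s) + g (max u t) - g s - g t := by
    intro u
    rcases le_total u s with hu | hu
    · simp [hu, hu.trans hst]; ring
    · rcases le_total u t with hu' | hu'
      · simp [hu, hu']; ring
      · simp [hu, hu', hst]; ring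
  have hstep : ∀ i ∈ Finset.range n, |g (r (i + 1)) - g (r i)| ≤ G (r (i + 1)) - G (r i) := by
    intro i _
    have hi : r i ≤ r (i + 1) := hr i.le_succ
    have a1 := h1 (Set.mem_Iic.2 (min_le_right (r i) s))
      (Set.mem_Iic.2 (min_le_right (r (i + 1)) s)) (min_le_min_right s hi)
    have a2 := h2 (a := max s (min (r i) t)) (b := max s (min (r (i + 1)) t))
      ⟨le_max_left _ _, max_le hst (min_le_right _ _)⟩
      ⟨le_max_left _ _, max_le hst (min_le_right _ _)⟩
      (max_le_max_left s (min_le_min_right t hi))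
    have a3 := h3 (Set.mem_Ici.2 (le_max_right (r i) t))
      (Set.mem_Ici.2 (le_max_right (r (i + 1)) t)) (max_le_max_right t hi)
    rw [hdecomp (r (i + 1)), hdecomp (r i), abs_le]
    simp only [hG]
    constructor <;> linarith
  have hbound : ∀ u, |G u| ≤ 3 * M := by
    intro u
    have b1 := abs_le.1 (hM (max s (min u t)))
    have b2 := abs_le.1 (hM (min u s))
    have b3 := abs_le.1 (hM (max u t))
    exact abs_le.2 ⟨by simp only [hG]; linarith, by simp only [hG]; linarith⟩
  refine (Finset.sum_le_sum hstep).trans ?_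
  rw [Finset.sum_range_sub (fun i => G (r i))]
  have c1 := abs_le.1 (hbound (r n))
  have c2 := abs_le.1 (hbound (r 0))
  linarith

/-- The `ℓ^q` norm is at most the `ℓ^1` norm for `q ≥ 1`. -/
theorem sum_rpow_rpow_one_div_le_sum {ι : Type*} (S : Finset ι) {f : ι → ℝ} (hf : ∀ i, 0 ≤ f i)
    {q : ℝ} (hq : 1 ≤ q) : (∑ i ∈ S, f i ^ q) ^ (1 / q) ≤ ∑ i ∈ S, f i := by
  have hS : 0 ≤ ∑ i ∈ S, f i := Finset.sum_nonneg fun i _ => hf i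
  have hsplit : ∀ x : ℝ, 0 ≤ x → x ^ q = x * x ^ (q - 1) := fun x hx => by
    rw [← Real.rpow_one_add' hx (by linarith), add_sub_cancel]
  have h : ∑ i ∈ S, f i ^ q ≤ (∑ i ∈ S, f i) ^ q := by
    rw [hsplit _ hS, Finset.sum_mul]
    refine Finset.sum_le_sum fun i hi => ?_
    rw [hsplit _ (hf i)]
    exact mul_le_mul_of_nonneg_left (Real.rpow_le_rpow (hf i)
      (Finset.single_le_sum (fun j _ => hf j) hi) (by linarith)) (hf i)
  calc (∑ i ∈ S, f i ^ q) ^ (1 / q) ≤ ((∑ i ∈ S, f i) ^ q) ^ (1 / q) :=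
        Real.rpow_le_rpow (Finset.sum_nonneg fun i _ => Real.rpow_nonneg (hf i) q) h
          (by positivity)
    _ = ∑ i ∈ S, f i := by
        rw [← Real.rpow_mul hS, mul_one_div_cancel (by linarith), Real.rpow_one]

/-- Partition sums of the total variation of `u ↦ |u - s| ^ a - |u - t| ^ a`. -/
theorem sum_abs_sub_rpow_sub_rpow_le {a s t : ℝ} (ha0 : 0 ≤ a) (ha1 : a ≤ 1) (hst : s < t)
    {r : ℕ → ℝ} (hr : Monotone r) (n : ℕ) :
    ∑ i ∈ Finset.range n, |(|r (i + 1) - s| ^ a - |r (i + 1) - t| ^ a)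
      - (|r i - s| ^ a - |r i - t| ^ a)| ≤ 6 * |t - s| ^ a := by
  refine sum_abs_sub_le_of_piecewise_monotone (g := fun u => |u - s| ^ a - |u - t| ^ a)
    hst.le ?_ ?_ ?_ ?_ hr n
  · intro u hu v hv huv
    simp only [Set.mem_Iic] at hu hv
    have h := rpow_add_rpow_add_le ha0 ha1 (sub_nonneg.2 hv) (by linarith : s - v ≤ s - u)
      (sub_pos.2 hst)
    simp only [abs_sub_comm _ s, abs_sub_comm _ t]
    rw [abs_of_nonneg (by linarith : 0 ≤ s - v), abs_of_nonneg (by linarith : 0 ≤ t - v),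
      abs_of_nonneg (by linarith : 0 ≤ s - u), abs_of_nonneg (by linarith : 0 ≤ t - u)]
    rw [show s - u + (t - s) = t - u by ring, show s - v + (t - s) = t - v by ring] at h
    linarith
  · intro u hu v hv huv
    have h1 : |u - s| ^ a ≤ |v - s| ^ a := Real.rpow_le_rpow (abs_nonneg _)
      (abs_le_abs_of_nonneg (sub_nonneg.2 hu.1) (by linarith)) ha0
    have h2 : |v - t| ^ a ≤ |u - t| ^ a := by
      rw [abs_sub_comm v, abs_sub_comm u]
      exact Real.rpow_le_rpow (abs_nonneg _)
        (abs_le_abs_of_nonneg (sub_nonneg.2 hv.2) (by linarith)) ha0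
    exact sub_le_sub h1 h2
  · intro u hu v hv huv
    simp only [Set.mem_Ici] at hu hv
    have h := rpow_add_rpow_add_le ha0 ha1 (sub_nonneg.2 hu) (by linarith : u - t ≤ v - t)
      (sub_pos.2 hst)
    simp only
    rw [abs_of_nonneg (by linarith : 0 ≤ v - s), abs_of_nonneg (by linarith : 0 ≤ v - t),
      abs_of_nonneg (by linarith : 0 ≤ u - s), abs_of_nonneg (by linarith : 0 ≤ u - t)]
    rw [show u - t + (t - s) = u - s by ring, show v - t + (t - s) = v - s by ring] at h
    linarith
  · intro u
    have h := abs_abs_rpow_sub_abs_rpow_le ha0 ha1 (u - s) (u - t)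
    rwa [sub_sub_sub_cancel_left] at h


/-- For `H ∈ (1/4,1/2]` and `q := 2/(1+2H)`, there is a constant `C` such that for all
`0 ≤ s < t ≤ T`, every partition sum for the `q`-variation of `u ↦ R_H(t,u) − R_H(s,u)`
over `[0,T]` is bounded by `C |t − s|^{2H}`; i.e.
`‖R_H(t,·) − R_H(s,·)‖_{q-var;[0,T]} ≤ C |t−s|^{2H}`. -/
theorem fbm_increment_qvar_bound
    (T H : ℝ) (hT : 0 < T) (hH1 : 1 / 4 < H) (hH2 : H ≤ 1 / 2) :
    ∃ C : ℝ, ∀ s t : ℝ, 0 ≤ s → s < t → t ≤ T →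
      ∀ (n : ℕ) (r : ℕ → ℝ), Monotone r → r 0 = 0 → (∀ m, n ≤ m → r m = T) →
        (∑ i ∈ Finset.range n,
            |(fbmCov H t (r (i + 1)) - fbmCov H s (r (i + 1)))
              - (fbmCov H t (r i) - fbmCov H s (r i))| ^ (2 / (1 + 2 * H)))
          ^ (1 / (2 / (1 + 2 * H)))
        ≤ C * |t - s| ^ (2 * H) := by
  refine ⟨3, fun s t _ hst _ n r hr _ _ => ?_⟩
  refine (sum_rpow_rpow_one_div_le_sum _ (fun i => abs_nonneg _) ?_).trans ?_
  · rw [le_div_iff₀ (by linarith)]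
    linarith
  · have h := sum_abs_sub_rpow_sub_rpow_le (a := 2 * H) (by linarith) (by linarith) hst hr n
    have e : ∀ i, |(fbmCov H t (r (i + 1)) - fbmCov H s (r (i + 1)))
        - (fbmCov H t (r i) - fbmCov H s (r i))|
        = |(|r (i + 1) - s| ^ (2 * H) - |r (i + 1) - t| ^ (2 * H))
          - (|r i - s| ^ (2 * H) - |r i - t| ^ (2 * H))| / 2 := by
      intro i
      rw [← abs_two (α := ℝ), ← abs_div, abs_two]
      unfold fbmCov
      congr 1
      ring
    simp only [e]
    rw [← Finset.sum_div]
    linarith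
end

section
/- Let F be a real Hilbert space, K a Volterra kernel on [0,T]² satisfying Condition (A) with parameter α∈[0,1/4), and ψ(u,v)=𝟙_{[0,v)}(u)·ψ̃(u,v) with ψ̃:[0,T]²→F strongly λ-Hölder bi-continuous in the norm of F, λ>α. Set λ' := min(λ, 1/4). Then there exists a constant C'<∞ such that for all w_1,w_2∈[0,T], ∫_0^T ||K*(ψ(·,w_2)−ψ(·,w_1))(s)||_F² ds ≤ C'|w_2−w_1|^{2λ'}, where K* is applied to the one-parameter function s ↦ ψ(s,w_2)−ψ(s,w_1). -/
open MeasureTheory Set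

noncomputable section

/-- Condition (A) on a Volterra kernel `K` on `[0,T]²`, with `K'` the partial derivative
`∂K(t,s)/∂t`. -/
def VolterraCondA (T : ℝ) (K K' : ℝ → ℝ → ℝ) (α : ℝ) : Prop :=
  IntegrableOn (fun p : ℝ × ℝ => (K p.1 p.2) ^ 2) (Icc 0 T ×ˢ Icc 0 T) ∧
  (∀ s t : ℝ, t ≤ s → K t s = 0) ∧
  ∃ C : ℝ, ∀ s t : ℝ, 0 < s → s < t → t ≤ T →
    |K t s| ≤ C * s ^ (-α) * (t - s) ^ (-α) ∧
    HasDerivAt (fun r => K r s) (K' t s) t ∧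
    |K' t s| ≤ C * (t - s) ^ (-(α + 1))

/-- The operator `K*` acting on a one-parameter function `φ`:
`(K*φ)(s) := φ(s) K(T,s) + ∫_s^T [φ(r) − φ(s)] ∂K(r,s)/∂r dr`. -/
def Kstar {E : Type*} [NormedAddCommGroup E] [NormedSpace ℝ E]
    (T : ℝ) (K K' : ℝ → ℝ → ℝ) (φ : ℝ → E) (s : ℝ) : E :=
  K T s • φ s + ∫ r in Ioc s T, K' r s • (φ r - φ s)

/-- `ψ̃ : [0,T]² → E` is strongly `λ`-Hölder bi-continuous in the norm of `E`. -/
def StronglyHolderBi {E : Type*} [NormedAddCommGroup E]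
    (T lam : ℝ) (ψ : ℝ → ℝ → E) : Prop :=
  ∃ C : ℝ, ∀ u₁ u₂ v₁ v₂ : ℝ, u₁ ∈ Icc 0 T → u₂ ∈ Icc 0 T → v₁ ∈ Icc 0 T → v₂ ∈ Icc 0 T →
    ‖ψ u₂ v₁ - ψ u₁ v₁‖ ≤ C * |u₂ - u₁| ^ lam ∧
    ‖ψ u₁ v₂ - ψ u₁ v₁‖ ≤ C * |v₂ - v₁| ^ lam ∧
    ‖ψ u₁ v₁ + ψ u₂ v₂ - ψ u₁ v₂ - ψ u₂ v₁‖ ≤ C * |u₂ - u₁| ^ lam * |v₂ - v₁| ^ lam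

/-- The truncation `ψ(u,v) = 𝟙_{[0,v)}(u) ψ̃(u,v)`. -/
def diagTrunc {E : Type*} [NormedAddCommGroup E] (ψt : ℝ → ℝ → E) : ℝ → ℝ → E :=
  fun u v => Set.indicator (Ico 0 v) (fun u' => ψt u' v) u

theorem integrableOn_sub_left_rpow {a b e : ℝ} (he : 0 < e) (hab : a ≤ b) :
    IntegrableOn (fun r : ℝ => (r - a) ^ (e - 1)) (Ioc a b) := by
  rw [← intervalIntegrable_iff_integrableOn_Ioc_of_le hab]
  have h := (intervalIntegral.intervalIntegrable_rpow' (a := 0) (b := b - a)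
    (r := e - 1) (by linarith)).comp_sub_right a
  simpa using h

theorem setIntegral_sub_left_rpow {a b e : ℝ} (he : 0 < e) (hab : a ≤ b) :
    ∫ r in Ioc a b, (r - a) ^ (e - 1) = (b - a) ^ e / e := by
  rw [← intervalIntegral.integral_of_le hab,
    intervalIntegral.integral_comp_sub_right (fun x => x ^ (e - 1)) a,
    integral_rpow (Or.inl (by linarith))]
  simp [Real.zero_rpow he.ne']

theorem setLIntegral_sub_left_rpow {a b e : ℝ} (he : 0 < e) (hab : a ≤ b) :
    ∫⁻ r in Ioo a b, ENNReal.ofReal ((r - a) ^ (e - 1)) = ENNReal.ofReal ((b - a) ^ e / e) := by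
  rw [setLIntegral_congr Ioo_ae_eq_Ioc, ← ofReal_integral_eq_lintegral_ofReal
    (integrableOn_sub_left_rpow he hab), setIntegral_sub_left_rpow he hab]
  filter_upwards [ae_restrict_mem measurableSet_Ioc] with r hr
  exact Real.rpow_nonneg (by linarith [hr.1]) _

theorem setLIntegral_sub_right_rpow {a b e : ℝ} (he : 0 < e) (hab : a ≤ b) :
    ∫⁻ r in Ioo a b, ENNReal.ofReal ((b - r) ^ (e - 1)) = ENNReal.ofReal ((b - a) ^ e / e) := by
  have h := (Measure.measurePreserving_sub_left volume (a + b)).setLIntegral_comp_preimage_emb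
    (MeasurableEquiv.subLeft (a + b)).measurableEmbedding
    (fun r => ENNReal.ofReal ((r - a) ^ (e - 1))) (Ioo a b)
  rw [setLIntegral_sub_left_rpow he hab] at h
  rw [← h]
  have hs : (fun x => a + b - x) ⁻¹' Ioo a b = Ioo a b := by
    ext x; simp only [mem_preimage, mem_Ioo]; constructor <;> rintro ⟨h₁, h₂⟩ <;>
      constructor <;> linarith
  rw [hs]
  congr! 4 with r
  ring

theorem setLIntegral_sq_add_rpow_le {a b A β : ℝ} (hβ : β < 1 / 2) (hab : a ≤ b) :
    ∫⁻ s in Ioo a b, ENNReal.ofReal ((A * ((s - a) ^ (-β) + (b - s) ^ (-β))) ^ 2) ≤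
      ENNReal.ofReal (4 * A ^ 2 * ((b - a) ^ (1 - 2 * β) / (1 - 2 * β))) := by
  have he : 0 < 1 - 2 * β := by linarith
  have hsq : ∀ x : ℝ, 0 < x → (x ^ (-β)) ^ 2 = x ^ ((1 - 2 * β) - 1) := by
    intro x hx
    rw [← Real.rpow_natCast, ← Real.rpow_mul hx.le]
    congr 1; push_cast; ring
  calc ∫⁻ s in Ioo a b, ENNReal.ofReal ((A * ((s - a) ^ (-β) + (b - s) ^ (-β))) ^ 2)
      ≤ ∫⁻ s in Ioo a b, ENNReal.ofReal (2 * A ^ 2) *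
          (ENNReal.ofReal ((s - a) ^ ((1 - 2 * β) - 1)) +
            ENNReal.ofReal ((b - s) ^ ((1 - 2 * β) - 1))) := by
        refine setLIntegral_mono' measurableSet_Ioo fun s hs => ?_
        have h1 : 0 < s - a := by linarith [hs.1]
        have h2 : 0 < b - s := by linarith [hs.2]
        rw [← ENNReal.ofReal_add (by positivity) (by positivity),
          ← ENNReal.ofReal_mul (by positivity), ← hsq _ h1, ← hsq _ h2]
        refine ENNReal.ofReal_le_ofReal ?_
        have := mul_nonneg (sq_nonneg A) (sq_nonneg ((s - a) ^ (-β) - (b - s) ^ (-β)))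
        nlinarith
    _ = ENNReal.ofReal (4 * A ^ 2 * ((b - a) ^ (1 - 2 * β) / (1 - 2 * β))) := by
        have h0 : 0 ≤ (b - a) ^ (1 - 2 * β) / (1 - 2 * β) :=
          div_nonneg (Real.rpow_nonneg (by linarith) _) he.le
        rw [lintegral_const_mul _ (by fun_prop), lintegral_add_left (by fun_prop),
          setLIntegral_sub_left_rpow he hab, setLIntegral_sub_right_rpow he hab,
          ← ENNReal.ofReal_add h0 h0, ← ENNReal.ofReal_mul (by positivity)]
        congr 1; ring

theorem rpow_neg_le_mul_rpow_neg {x T a b : ℝ} (hx : 0 < x) (hxT : x ≤ T) (hab : a ≤ b) :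
    x ^ (-a) ≤ T ^ (b - a) * x ^ (-b) := by
  have : x ^ (-a) = x ^ (b - a) * x ^ (-b) := by rw [← Real.rpow_add hx]; congr 1; ring
  rw [this]
  gcongr

theorem rpow_le_mul_rpow {x T a b : ℝ} (hx : 0 ≤ x) (hxT : x ≤ T) (ha : 0 ≤ a) (hab : a ≤ b) :
    x ^ b ≤ T ^ (b - a) * x ^ a := by
  have : x ^ b = x ^ (b - a) * x ^ a := by
    rw [← Real.rpow_add_of_nonneg hx (by linarith) ha]; congr 1; ring
  rw [this]
  gcongr

theorem rpow_neg_add_one_le {x y α e : ℝ} (hx : 0 < x) (hxy : x ≤ y) (he : 0 ≤ α + e) :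
    y ^ (-(α + 1)) ≤ x ^ (-(α + e)) * y ^ (e - 1) := by
  have hy := hx.trans_le hxy
  have : y ^ (-(α + 1)) = y ^ (-(α + e)) * y ^ (e - 1) := by
    rw [← Real.rpow_add hy]; congr 1; ring
  rw [this]
  gcongr ?_ * _
  exact Real.rpow_le_rpow_of_nonpos hx hxy (by linarith)

theorem rpow_neg_mul_rpow_neg_le {s T α : ℝ} (hs : 0 < s) (hsT : s < T) (hα : 0 ≤ α) :
    s ^ (-α) * (T - s) ^ (-α) ≤ (T / 2) ^ (-α) * (s ^ (-α) + (T - s) ^ (-α)) := by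
  have hs' : 0 < T - s := by linarith
  have hT : 0 < T / 2 := by linarith
  have h1 : 0 ≤ s ^ (-α) := by positivity
  have h2 : 0 ≤ (T - s) ^ (-α) := by positivity
  have h3 : 0 ≤ (T / 2) ^ (-α) := by positivity
  rcases le_total s (T / 2) with h | h
  · have : (T - s) ^ (-α) ≤ (T / 2) ^ (-α) :=
      Real.rpow_le_rpow_of_nonpos hT (by linarith) (by linarith)
    nlinarith
  · have : s ^ (-α) ≤ (T / 2) ^ (-α) :=
      Real.rpow_le_rpow_of_nonpos hT h (by linarith)
    nlinarith

theorem norm_Kstar_le_add {E : Type*} [NormedAddCommGroup E] [NormedSpace ℝ E]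
    {T : ℝ} {K K' : ℝ → ℝ → ℝ} {φ : ℝ → E} {s k p : ℝ} {g : ℝ → ℝ}
    (hk : |K T s| ≤ k) (hp : ‖φ s‖ ≤ p) (hg : IntegrableOn g (Ioc s T))
    (h : ∀ᵐ r, r ∈ Ioc s T → ‖K' r s • (φ r - φ s)‖ ≤ g r) :
    ‖Kstar T K K' φ s‖ ≤ k * p + ∫ r in Ioc s T, g r := by
  refine (norm_add_le _ _).trans (add_le_add ?_ ?_)
  · rw [norm_smul, Real.norm_eq_abs]
    exact mul_le_mul hk hp (norm_nonneg _) ((abs_nonneg _).trans hk)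
  · exact norm_integral_le_of_norm_le hg ((ae_restrict_iff' measurableSet_Ioc).2 h)

/-- Pointwise bound for `K*φ` to the left of the strip `[w₁, w₂)`. -/
theorem norm_Kstar_le_of_lt_left {E : Type*} [NormedAddCommGroup E] [NormedSpace ℝ E]
    {T : ℝ} {K K' : ℝ → ℝ → ℝ} {α lam C P d w₁ w₂ s : ℝ} {φ : ℝ → E}
    (hα0 : 0 ≤ α) (hlam : α < lam) (hC : 0 ≤ C) (hP : 0 ≤ P) (hd : 0 ≤ d)
    (hK : ∀ s t : ℝ, 0 < s → s < t → t ≤ T →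
      |K t s| ≤ C * s ^ (-α) * (t - s) ^ (-α) ∧ |K' t s| ≤ C * (t - s) ^ (-(α + 1)))
    (hs : 0 < s) (hsw : s < w₁) (hw : w₁ ≤ w₂) (hwT : w₂ ≤ T)
    (h0 : ‖φ s‖ ≤ P * d)
    (h1 : ∀ r, s < r → r < w₁ → ‖φ r - φ s‖ ≤ P * d * (r - s) ^ lam)
    (h2 : ∀ r, w₁ ≤ r → r < w₂ → ‖φ r - φ s‖ ≤ P)
    (h3 : ∀ r, w₂ ≤ r → r ≤ T → ‖φ r - φ s‖ ≤ P * d) :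
    ‖Kstar T K K' φ s‖ ≤ C * P * (d * ((T / 2) ^ (-α) * (s ^ (-α) + (T - s) ^ (-α)))
      + d * (T ^ (lam - α) / (lam - α)) + d * (w₁ - s) ^ (-(α + 1 / 4)) * (4 * T ^ (1 / 4 : ℝ))
      + (w₁ - s) ^ (-(α + 1 / 4)) * (4 * (w₂ - w₁) ^ (1 / 4 : ℝ))) := by
  have hsT : s < T := by linarith
  have hws : 0 < w₁ - s := by linarith
  set y := (w₁ - s) ^ (-(α + 1 / 4)) with hy
  have hy0 : 0 ≤ y := by positivity
  have i1 := integrableOn_sub_left_rpow (sub_pos.2 hlam) hsT.le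
  have i2 := integrableOn_sub_left_rpow (e := 1 / 4) (by norm_num) hsT.le
  have i3 := (integrableOn_sub_left_rpow (e := 1 / 4) (by norm_num) hw)
  have i3' : IntegrableOn ((Ioc w₁ w₂).indicator fun r => (r - w₁) ^ ((1 / 4 : ℝ) - 1))
      (Ioc s T) :=
    ((integrable_indicator_iff measurableSet_Ioc).2 i3).integrableOn
  have hKT := (hK s T hs hsT le_rfl).1
  rw [mul_assoc] at hKT
  refine (norm_Kstar_le_add (g := fun r => C * P * (d * (r - s) ^ (lam - α - 1)
      + d * y * (r - s) ^ ((1 / 4 : ℝ) - 1)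
      + y * (Ioc w₁ w₂).indicator (fun r => (r - w₁) ^ ((1 / 4 : ℝ) - 1)) r))
      hKT h0 ?_ ?_).trans ?_
  · exact (((i1.const_mul _).add (i2.const_mul _)).add (i3'.const_mul _)).const_mul _
  · filter_upwards [compl_mem_ae_iff.2 (measure_singleton (μ := volume) w₁)] with r hr1 hr
    have hrs : 0 < r - s := by linarith [hr.1]
    have hK' := (hK s r hs hr.1 hr.2).2
    have hind : 0 ≤ (Ioc w₁ w₂).indicator (fun r => (r - w₁) ^ ((1 / 4 : ℝ) - 1)) r :=
      indicator_nonneg (fun x hx => Real.rpow_nonneg (by linarith [hx.1]) _) _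
    have t1 : 0 ≤ d * (r - s) ^ (lam - α - 1) := by positivity
    have t2 : 0 ≤ d * y * (r - s) ^ ((1 / 4 : ℝ) - 1) := by positivity
    have t3 := mul_nonneg hy0 hind
    have hCP : 0 ≤ C * P := mul_nonneg hC hP
    rw [norm_smul, Real.norm_eq_abs]
    rcases lt_or_ge r w₁ with h | h
    · calc |K' r s| * ‖φ r - φ s‖
          ≤ (C * (r - s) ^ (-(α + 1))) * (P * d * (r - s) ^ lam) :=
            mul_le_mul hK' (h1 r hr.1 h) (norm_nonneg _) (by positivity)
        _ = C * P * (d * (r - s) ^ (lam - α - 1)) := by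
            have : (r - s) ^ (lam - α - 1) = (r - s) ^ (-(α + 1)) * (r - s) ^ lam := by
              rw [← Real.rpow_add hrs]; congr 1; ring
            rw [this]; ring
        _ ≤ _ := mul_le_mul_of_nonneg_left (by linarith) hCP
    · have hsplit := rpow_neg_add_one_le (α := α) (e := 1 / 4) hws
        (sub_le_sub_right h s) (by linarith)
      rcases lt_or_ge r w₂ with h' | h'
      · have hlt : w₁ < r := lt_of_le_of_ne h fun h => hr1 h.symm
        have hmono : (r - s) ^ ((1 / 4 : ℝ) - 1) ≤ (r - w₁) ^ ((1 / 4 : ℝ) - 1) :=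
          Real.rpow_le_rpow_of_nonpos (by linarith) (by linarith) (by norm_num)
        have hmem : r ∈ Ioc w₁ w₂ := ⟨hlt, h'.le⟩
        calc |K' r s| * ‖φ r - φ s‖
            ≤ (C * (y * (r - w₁) ^ ((1 / 4 : ℝ) - 1))) * P := by
              refine mul_le_mul (hK'.trans ?_) (h2 r h h') (norm_nonneg _) ?_
              · exact mul_le_mul_of_nonneg_left
                  (hsplit.trans (mul_le_mul_of_nonneg_left hmono hy0)) hC
              · have : 0 < r - w₁ := by linarith
                positivity
          _ = C * P * (y * (Ioc w₁ w₂).indicator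
                (fun r => (r - w₁) ^ ((1 / 4 : ℝ) - 1)) r) := by
              rw [indicator_of_mem hmem]; ring
          _ ≤ _ := mul_le_mul_of_nonneg_left (by linarith) hCP
      · calc |K' r s| * ‖φ r - φ s‖
            ≤ (C * (y * (r - s) ^ ((1 / 4 : ℝ) - 1))) * (P * d) :=
              mul_le_mul (hK'.trans (mul_le_mul_of_nonneg_left hsplit hC)) (h3 r h' hr.2)
                (norm_nonneg _) (by positivity)
          _ = C * P * (d * y * (r - s) ^ ((1 / 4 : ℝ) - 1)) := by ring
          _ ≤ _ := mul_le_mul_of_nonneg_left (by linarith) hCP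
  · have hcap : Ioc s T ∩ Ioc w₁ w₂ = Ioc w₁ w₂ :=
      inter_eq_right.2 (Ioc_subset_Ioc hsw.le hwT)
    have e1 : (T - s) ^ (lam - α) / (lam - α) ≤ T ^ (lam - α) / (lam - α) := by
      have : 0 < lam - α := by linarith
      gcongr
      all_goals linarith
    have e2 : (T - s) ^ (1 / 4 : ℝ) ≤ T ^ (1 / 4 : ℝ) := by
      gcongr
      all_goals linarith
    have i12 : IntegrableOn (fun r => d * (r - s) ^ (lam - α - 1)
        + d * y * (r - s) ^ ((1 / 4 : ℝ) - 1)) (Ioc s T) :=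
      (i1.const_mul _).add (i2.const_mul _)
    rw [integral_const_mul, integral_add i12 (i3'.const_mul _), integral_add (i1.const_mul _) (i2.const_mul _), integral_const_mul,
      integral_const_mul, integral_const_mul, setIntegral_indicator measurableSet_Ioc, hcap,
      setIntegral_sub_left_rpow (sub_pos.2 hlam) hsT.le,
      setIntegral_sub_left_rpow (by norm_num) hsT.le,
      setIntegral_sub_left_rpow (by norm_num) hw]
    calc _ = C * P * (d * (s ^ (-α) * (T - s) ^ (-α)) + d * ((T - s) ^ (lam - α) / (lam - α))
          + d * y * (4 * (T - s) ^ (1 / 4 : ℝ)) + y * (4 * (w₂ - w₁) ^ (1 / 4 : ℝ))) := by ring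
      _ ≤ _ := by
        have := rpow_neg_mul_rpow_neg_le hs hsT hα0
        gcongr

/-- Pointwise bound for `K*φ` inside the strip `(w₁, w₂)`. -/
theorem norm_Kstar_le_of_mem_strip {E : Type*} [NormedAddCommGroup E] [NormedSpace ℝ E]
    {T : ℝ} {K K' : ℝ → ℝ → ℝ} {α lam C P w₂ s : ℝ} {φ : ℝ → E}
    (hα0 : 0 ≤ α) (hα : α < 1 / 4) (hlam : α < lam) (hC : 0 ≤ C) (hP : 0 ≤ P)
    (hK : ∀ s t : ℝ, 0 < s → s < t → t ≤ T →
      |K t s| ≤ C * s ^ (-α) * (t - s) ^ (-α) ∧ |K' t s| ≤ C * (t - s) ^ (-(α + 1)))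
    (hs : 0 < s) (hsw : s < w₂) (hwT : w₂ ≤ T)
    (h0 : ‖φ s‖ ≤ P)
    (h1 : ∀ r, s < r → r < w₂ → ‖φ r - φ s‖ ≤ P * (r - s) ^ lam)
    (h2 : ∀ r, w₂ ≤ r → r ≤ T → ‖φ r - φ s‖ ≤ P) :
    ‖Kstar T K K' φ s‖ ≤ C * P * ((T / 2) ^ (-α) * (s ^ (-α) + (T - s) ^ (-α))
      + T ^ (lam - α) / (lam - α)
      + (w₂ - s) ^ (-(1 / 4) : ℝ) * (T ^ (1 / 4 - α) / (1 / 4 - α))) := by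
  have hsT : s < T := by linarith
  have hws : 0 < w₂ - s := by linarith
  set y := (w₂ - s) ^ (-(1 / 4) : ℝ) with hy
  have hy0 : 0 ≤ y := by positivity
  have i1 := integrableOn_sub_left_rpow (sub_pos.2 hlam) hsT.le
  have i2 := integrableOn_sub_left_rpow (sub_pos.2 hα) hsT.le
  have hKT := (hK s T hs hsT le_rfl).1
  rw [mul_assoc] at hKT
  refine (norm_Kstar_le_add (g := fun r => C * P * ((r - s) ^ (lam - α - 1)
      + y * (r - s) ^ (1 / 4 - α - 1))) hKT h0 ?_ ?_).trans ?_
  · exact (i1.add (i2.const_mul _)).const_mul _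
  · refine Filter.Eventually.of_forall fun r hr => ?_
    have hrs : 0 < r - s := by linarith [hr.1]
    have hK' := (hK s r hs hr.1 hr.2).2
    have t1 : 0 ≤ (r - s) ^ (lam - α - 1) := by positivity
    have t2 : 0 ≤ y * (r - s) ^ (1 / 4 - α - 1) := by positivity
    have hCP : 0 ≤ C * P := mul_nonneg hC hP
    rw [norm_smul, Real.norm_eq_abs]
    rcases lt_or_ge r w₂ with h | h
    · calc |K' r s| * ‖φ r - φ s‖
          ≤ (C * (r - s) ^ (-(α + 1))) * (P * (r - s) ^ lam) :=
            mul_le_mul hK' (h1 r hr.1 h) (norm_nonneg _) (by positivity)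
        _ = C * P * (r - s) ^ (lam - α - 1) := by
            have : (r - s) ^ (lam - α - 1) = (r - s) ^ (-(α + 1)) * (r - s) ^ lam := by
              rw [← Real.rpow_add hrs]; congr 1; ring
            rw [this]; ring
        _ ≤ _ := mul_le_mul_of_nonneg_left (by linarith) hCP
    · have hsplit := rpow_neg_add_one_le (α := α) (e := 1 / 4 - α) hws
        (sub_le_sub_right h s) (by linarith)
      rw [add_sub_cancel] at hsplit
      calc |K' r s| * ‖φ r - φ s‖
          ≤ (C * (y * (r - s) ^ (1 / 4 - α - 1))) * P :=
            mul_le_mul (hK'.trans (mul_le_mul_of_nonneg_left hsplit hC)) (h2 r h hr.2)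
              (norm_nonneg _) (by positivity)
        _ = C * P * (y * (r - s) ^ (1 / 4 - α - 1)) := by ring
        _ ≤ _ := mul_le_mul_of_nonneg_left (by linarith) hCP
  · have e1 : (T - s) ^ (lam - α) / (lam - α) ≤ T ^ (lam - α) / (lam - α) := by
      have : 0 < lam - α := by linarith
      gcongr
      all_goals linarith
    have e2 : (T - s) ^ (1 / 4 - α) / (1 / 4 - α) ≤ T ^ (1 / 4 - α) / (1 / 4 - α) := by
      have : 0 < 1 / 4 - α := by linarith
      gcongr
      all_goals linarith
    rw [integral_const_mul, integral_add i1 (i2.const_mul _), integral_const_mul,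
      setIntegral_sub_left_rpow (sub_pos.2 hlam) hsT.le,
      setIntegral_sub_left_rpow (sub_pos.2 hα) hsT.le]
    calc _ = C * P * ((s ^ (-α) * (T - s) ^ (-α)) + (T - s) ^ (lam - α) / (lam - α)
          + y * ((T - s) ^ (1 / 4 - α) / (1 / 4 - α))) := by ring
      _ ≤ _ := by
        have := rpow_neg_mul_rpow_neg_le hs hsT hα0
        gcongr

theorem exists_left_bound {T α lam lam' : ℝ} (C P : ℝ) (hα0 : 0 ≤ α)
    (hlam : α < lam) (hC : 0 ≤ C) (hP : 0 ≤ P) (h0 : 0 ≤ lam') (hl : lam' ≤ lam)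
    (hl4 : lam' ≤ 1 / 4) :
    ∃ A : ℝ, ∀ w₁ w₂ s : ℝ, 0 < s → s < w₁ → w₁ ≤ w₂ → w₂ ≤ T →
      C * P * ((w₂ - w₁) ^ lam * ((T / 2) ^ (-α) * (s ^ (-α) + (T - s) ^ (-α)))
      + (w₂ - w₁) ^ lam * (T ^ (lam - α) / (lam - α))
      + (w₂ - w₁) ^ lam * (w₁ - s) ^ (-(α + 1 / 4)) * (4 * T ^ (1 / 4 : ℝ))
      + (w₁ - s) ^ (-(α + 1 / 4)) * (4 * (w₂ - w₁) ^ (1 / 4 : ℝ))) ≤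
      A * (w₂ - w₁) ^ lam' * (s ^ (-(α + 1 / 4)) + (w₁ - s) ^ (-(α + 1 / 4))) := by
  refine ⟨C * P * (T ^ (lam - lam') * ((T / 2) ^ (-α) * T ^ (1 / 4 : ℝ)
    + T ^ (lam - α) / (lam - α) * T ^ (α + 1 / 4) + 4 * T ^ (1 / 4 : ℝ))
    + 4 * T ^ (1 / 4 - lam')), fun w₁ w₂ s hs hsw hw hwT => ?_⟩
  have hT : 0 < T := by linarith
  have hκ : 0 < lam - α := by linarith
  have hws : 0 < w₁ - s := by linarith
  have hTs : 0 < T - s := by linarith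
  have hd0 : 0 ≤ w₂ - w₁ := by linarith
  have hdT : w₂ - w₁ ≤ T := by linarith
  have hd1 := rpow_le_mul_rpow hd0 hdT h0 hl
  have hd2 := rpow_le_mul_rpow hd0 hdT h0 hl4
  have hx1 := rpow_neg_le_mul_rpow_neg (a := α) (b := α + 1 / 4) hs (by linarith : s ≤ T)
    (by linarith)
  have hx2 := rpow_neg_le_mul_rpow_neg (a := 0) (b := α + 1 / 4) hs (by linarith : s ≤ T)
    (by linarith)
  have hy1 := rpow_neg_le_mul_rpow_neg (a := α) (b := α + 1 / 4) hws
    (by linarith : w₁ - s ≤ T) (by linarith)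
  have hy2 : (T - s) ^ (-α) ≤ (w₁ - s) ^ (-α) :=
    Real.rpow_le_rpow_of_nonpos hws (by linarith) (by linarith)
  rw [neg_zero, Real.rpow_zero, sub_zero] at hx2
  rw [add_sub_cancel_left] at hx1 hy1
  have hx0 : 0 ≤ s ^ (-(α + 1 / 4)) := by positivity
  have hy0 : 0 ≤ (w₁ - s) ^ (-(α + 1 / 4)) := by positivity
  have hz0 : 0 ≤ (w₂ - w₁) ^ lam' := by positivity
  set x := s ^ (-(α + 1 / 4))
  set y := (w₁ - s) ^ (-(α + 1 / 4))
  set z := (w₂ - w₁) ^ lam'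
  have b1 : s ^ (-α) + (T - s) ^ (-α) ≤ T ^ (1 / 4 : ℝ) * (x + y) := by linarith
  have b2 : 1 ≤ T ^ (α + 1 / 4) * (x + y) :=
    hx2.trans (by gcongr; linarith)
  have b3 : y ≤ x + y := by linarith
  calc _ ≤ C * P * ((T ^ (lam - lam') * z) * ((T / 2) ^ (-α) * (T ^ (1 / 4 : ℝ) * (x + y)))
      + (T ^ (lam - lam') * z) * (T ^ (lam - α) / (lam - α) * (T ^ (α + 1 / 4) * (x + y)))
      + (T ^ (lam - lam') * z) * (x + y) * (4 * T ^ (1 / 4 : ℝ))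
      + (x + y) * (4 * (T ^ (1 / 4 - lam') * z))) := by
        gcongr
        exact le_mul_of_one_le_right (by positivity) b2
    _ = _ := by ring

theorem exists_strip_bound {T α lam : ℝ} (C P : ℝ) (hα0 : 0 ≤ α) (hα : α < 1 / 4)
    (hlam : α < lam) (hC : 0 ≤ C) (hP : 0 ≤ P) :
    ∃ B : ℝ, ∀ w₁ w₂ s : ℝ, 0 ≤ w₁ → w₁ < s → s < w₂ → w₂ ≤ T →
      C * P * ((T / 2) ^ (-α) * (s ^ (-α) + (T - s) ^ (-α)) + T ^ (lam - α) / (lam - α)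
      + (w₂ - s) ^ (-(1 / 4) : ℝ) * (T ^ (1 / 4 - α) / (1 / 4 - α))) ≤
      B * ((s - w₁) ^ (-(1 / 4) : ℝ) + (w₂ - s) ^ (-(1 / 4) : ℝ)) := by
  refine ⟨C * P * ((T / 2) ^ (-α) * T ^ (1 / 4 - α)
    + T ^ (lam - α) / (lam - α) * T ^ (1 / 4 : ℝ) + T ^ (1 / 4 - α) / (1 / 4 - α)),
    fun w₁ w₂ s hw hsw hs hwT => ?_⟩
  have hT : 0 < T := by linarith
  have hκ : 0 < lam - α := by linarith
  have hκ' : 0 < 1 / 4 - α := by linarith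
  have hsw' : 0 < s - w₁ := by linarith
  have hws : 0 < w₂ - s := by linarith
  have hx1 := rpow_neg_le_mul_rpow_neg (a := α) (b := 1 / 4) hsw' (by linarith : s - w₁ ≤ T)
    hα.le
  have hx2 := rpow_neg_le_mul_rpow_neg (a := 0) (b := 1 / 4) hsw' (by linarith : s - w₁ ≤ T)
    (by norm_num)
  have hx3 : s ^ (-α) ≤ (s - w₁) ^ (-α) :=
    Real.rpow_le_rpow_of_nonpos hsw' (by linarith) (by linarith)
  have hy1 := rpow_neg_le_mul_rpow_neg (a := α) (b := 1 / 4) hws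
    (by linarith : w₂ - s ≤ T) hα.le
  have hy2 : (T - s) ^ (-α) ≤ (w₂ - s) ^ (-α) :=
    Real.rpow_le_rpow_of_nonpos hws (by linarith) (by linarith)
  rw [neg_zero, Real.rpow_zero, sub_zero] at hx2
  have hx0 : 0 ≤ (s - w₁) ^ (-(1 / 4) : ℝ) := by positivity
  have hy0 : 0 ≤ (w₂ - s) ^ (-(1 / 4) : ℝ) := by positivity
  set x := (s - w₁) ^ (-(1 / 4) : ℝ)
  set y := (w₂ - s) ^ (-(1 / 4) : ℝ)
  have b1 : s ^ (-α) + (T - s) ^ (-α) ≤ T ^ (1 / 4 - α) * (x + y) := by linarith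
  have b2 : 1 ≤ T ^ (1 / 4 : ℝ) * (x + y) :=
    hx2.trans (by gcongr; linarith)
  have b3 : y ≤ x + y := by linarith
  calc _ ≤ C * P * ((T / 2) ^ (-α) * (T ^ (1 / 4 - α) * (x + y))
      + T ^ (lam - α) / (lam - α) * (T ^ (1 / 4 : ℝ) * (x + y))
      + (x + y) * (T ^ (1 / 4 - α) / (1 / 4 - α))) := by
        gcongr
        exact le_mul_of_one_le_right (by positivity) b2
    _ = _ := by ring

theorem Kstar_neg {E : Type*} [NormedAddCommGroup E] [NormedSpace ℝ E]
    (T : ℝ) (K K' : ℝ → ℝ → ℝ) (φ : ℝ → E) (s : ℝ) :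
    Kstar T K K' (fun u => -φ u) s = -Kstar T K K' φ s := by
  have : ∀ r, K' r s • (-φ r - -φ s) = -(K' r s • (φ r - φ s)) := fun r => by
    rw [← smul_neg]; congr 1; abel
  simp only [Kstar, this, integral_neg, smul_neg, neg_add]

/-- If `f` is dominated by the two singular profiles on `(0, w₁)` and `(w₁, w₂)` and vanishes beyond
`w₂`, its `L²` norm is controlled by those of the profiles. -/
theorem lintegral_sq_le_of_two_sided_bound {E : Type*} [NormedAddCommGroup E]
    {T w₁ w₂ A B β γ : ℝ} {f : ℝ → E} (hβ : β < 1 / 2) (hγ : γ < 1 / 2)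
    (h1 : 0 ≤ w₁) (h2 : w₁ ≤ w₂)
    (hA : ∀ s, 0 < s → s < w₁ → ‖f s‖ ≤ A * (s ^ (-β) + (w₁ - s) ^ (-β)))
    (hB : ∀ s, w₁ < s → s < w₂ → ‖f s‖ ≤ B * ((s - w₁) ^ (-γ) + (w₂ - s) ^ (-γ)))
    (h0 : ∀ s, w₂ ≤ s → f s = 0) :
    ∫⁻ s in Icc (0 : ℝ) T, (‖f s‖₊ : ENNReal) ^ 2 ≤
      ENNReal.ofReal (4 * A ^ 2 * (w₁ ^ (1 - 2 * β) / (1 - 2 * β))) +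
      ENNReal.ofReal (4 * B ^ 2 * ((w₂ - w₁) ^ (1 - 2 * γ) / (1 - 2 * γ))) := by
  have key : ∀ (s x : ℝ), ‖f s‖ ≤ x → (‖f s‖₊ : ENNReal) ^ 2 ≤ ENNReal.ofReal (x ^ 2) := by
    intro s x hx
    rw [ENNReal.ofReal_pow ((norm_nonneg _).trans hx), ← enorm_eq_nnnorm, ← ofReal_norm]
    gcongr
  have hle := setLIntegral_sq_add_rpow_le (A := A) hβ h1
  simp only [sub_zero] at hle
  refine le_trans ?_ (add_le_add hle (setLIntegral_sq_add_rpow_le (A := B) hγ h2))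
  rw [← lintegral_indicator measurableSet_Ioo, ← lintegral_indicator measurableSet_Ioo,
    ← lintegral_add_left (Measurable.indicator (by fun_prop) measurableSet_Ioo)]
  refine le_trans (lintegral_mono_ae ?_) (setLIntegral_le_lintegral (Icc 0 T) _)
  filter_upwards [ae_restrict_mem measurableSet_Icc,
    ae_restrict_of_ae (compl_mem_ae_iff.2 (measure_singleton (μ := volume) 0)),
    ae_restrict_of_ae (compl_mem_ae_iff.2 (measure_singleton (μ := volume) w₁))] with s hs hs0 hs1
  have hs0' : 0 < s := lt_of_le_of_ne hs.1 fun h => hs0 h.symm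
  rcases lt_or_ge s w₁ with h | h
  · rw [indicator_of_mem (show s ∈ Ioo 0 w₁ from ⟨hs0', h⟩)]
    exact (key s _ (hA s hs0' h)).trans le_self_add
  have h' : w₁ < s := lt_of_le_of_ne h fun h => hs1 h.symm
  rcases lt_or_ge s w₂ with h'' | h''
  · rw [indicator_of_mem (show s ∈ Ioo w₁ w₂ from ⟨h', h''⟩)]
    exact (key s _ (hB s h' h'')).trans le_add_self
  · simp [h0 s h'']

/-- For a Volterra kernel satisfying Condition (A) with `α ∈ [0,1/4)` and
`ψ(u,v) = 𝟙_{[0,v)}(u) ψ̃(u,v)` with `ψ̃ : [0,T]² → F` strongly `λ`-Hölder bi-continuous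
(`λ > α`, `F` a real Hilbert space), setting `λ' := min(λ,1/4)`, there is a constant `C'` such
that `∫_0^T ‖K*(ψ(·,w₂) − ψ(·,w₁))(s)‖² ds ≤ C' |w₂ − w₁|^{2λ'}` for all `w₁,w₂ ∈ [0,T]`. -/
theorem Kstar_column_increment_L2_bound
    {F : Type*} [NormedAddCommGroup F] [InnerProductSpace ℝ F] [CompleteSpace F]
    (T : ℝ) (hT : 0 < T) (K K' : ℝ → ℝ → ℝ) (α : ℝ) (hα0 : 0 ≤ α) (hα : α < 1 / 4)
    (hK : VolterraCondA T K K' α)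
    (lam : ℝ) (hlam : α < lam)
    (ψt : ℝ → ℝ → F) (hψt : StronglyHolderBi T lam ψt) :
    ∃ C' : ℝ, ∀ w₁ w₂ : ℝ, w₁ ∈ Icc (0:ℝ) T → w₂ ∈ Icc (0:ℝ) T →
      ∫⁻ s in Icc (0:ℝ) T,
          (‖Kstar T K K' (fun u => diagTrunc ψt u w₂ - diagTrunc ψt u w₁) s‖₊ : ENNReal) ^ 2
        ≤ ENNReal.ofReal (C' * |w₂ - w₁| ^ (2 * min lam (1 / 4))) := by
  obtain ⟨-, -, C₀, hC₀⟩ := hK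
  obtain ⟨P₀, hP₀⟩ := hψt
  have hlam0 : 0 < lam := hα0.trans_lt hlam
  obtain ⟨C, hC, hKC⟩ : ∃ C : ℝ, 0 ≤ C ∧ ∀ s t : ℝ, 0 < s → s < t → t ≤ T →
      |K t s| ≤ C * s ^ (-α) * (t - s) ^ (-α) ∧ |K' t s| ≤ C * (t - s) ^ (-(α + 1)) := by
    refine ⟨|C₀|, abs_nonneg _, fun s t hs hst ht => ?_⟩
    obtain ⟨k1, -, k2⟩ := hC₀ s t hs hst ht
    have := sub_pos.2 hst
    have := le_abs_self C₀
    exact ⟨k1.trans (by gcongr), k2.trans (by gcongr)⟩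
  have hψ : ∀ u₁ u₂ v₁ v₂ : ℝ, u₁ ∈ Icc 0 T → u₂ ∈ Icc 0 T → v₁ ∈ Icc 0 T → v₂ ∈ Icc 0 T →
      ‖ψt u₂ v₁ - ψt u₁ v₁‖ ≤ |P₀| * |u₂ - u₁| ^ lam ∧
      ‖ψt u₁ v₂ - ψt u₁ v₁‖ ≤ |P₀| * |v₂ - v₁| ^ lam ∧
      ‖ψt u₁ v₁ + ψt u₂ v₂ - ψt u₁ v₂ - ψt u₂ v₁‖ ≤
        |P₀| * |u₂ - u₁| ^ lam * |v₂ - v₁| ^ lam := by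
    intro u₁ u₂ v₁ v₂ hu₁ hu₂ hv₁ hv₂
    obtain ⟨k1, k2, k3⟩ := hP₀ u₁ u₂ v₁ v₂ hu₁ hu₂ hv₁ hv₂
    have := le_abs_self P₀
    exact ⟨k1.trans (by gcongr), k2.trans (by gcongr), k3.trans (by gcongr)⟩
  obtain ⟨M, hM⟩ : ∃ M : ℝ, ∀ u ∈ Icc 0 T, ∀ v ∈ Icc 0 T, ‖ψt u v‖ ≤ M := by
    refine ⟨‖ψt 0 0‖ + |P₀| * T ^ lam + |P₀| * T ^ lam, fun u hu v hv => ?_⟩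
    have z : (0 : ℝ) ∈ Icc 0 T := ⟨le_rfl, hT.le⟩
    have k1 := (hψ 0 u v v z hu hv hv).1
    have k2 := (hψ 0 0 0 v z z z hv).2.1
    rw [sub_zero, abs_of_nonneg hu.1] at k1
    rw [sub_zero, abs_of_nonneg hv.1] at k2
    have hu' : u ^ lam ≤ T ^ lam := Real.rpow_le_rpow hu.1 hu.2 hlam0.le
    have hv' : v ^ lam ≤ T ^ lam := Real.rpow_le_rpow hv.1 hv.2 hlam0.le
    have k1' := k1.trans (mul_le_mul_of_nonneg_left hu' (abs_nonneg P₀))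
    have k2' := k2.trans (mul_le_mul_of_nonneg_left hv' (abs_nonneg P₀))
    have e : ψt u v = ψt 0 0 + (ψt 0 v - ψt 0 0) + (ψt u v - ψt 0 v) := by abel
    rw [e]
    exact norm_add₃_le.trans (by linarith)
  have hM0 : 0 ≤ M :=
    (norm_nonneg _).trans (hM 0 ⟨le_rfl, hT.le⟩ 0 ⟨le_rfl, hT.le⟩)
  obtain ⟨P, hP, hPP, hPM⟩ : ∃ P : ℝ, 0 ≤ P ∧ |P₀| ≤ P ∧ 3 * M ≤ P :=
    ⟨|P₀| + 3 * M, by positivity, by linarith, by linarith [abs_nonneg P₀]⟩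
  set lam' := min lam (1 / 4) with hlam'
  have hl0 : 0 ≤ lam' := le_min hlam0.le (by norm_num)
  have hl4 : lam' ≤ 1 / 4 := min_le_right _ _
  obtain ⟨A, hA⟩ := exists_left_bound (T := T) C P hα0 hlam hC hP hl0 (min_le_left _ _) hl4
  obtain ⟨B, hB⟩ := exists_strip_bound (T := T) C P hα0 hα hlam hC hP
  have hβ : 0 < 1 - 2 * (α + 1 / 4) := by linarith
  refine ⟨4 * A ^ 2 * (T ^ (1 - 2 * (α + 1 / 4)) / (1 - 2 * (α + 1 / 4)))
    + 8 * B ^ 2 * T ^ (1 / 2 - 2 * lam'), ?_⟩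
  intro w₁ w₂ hw₁ hw₂
  wlog hw : w₁ ≤ w₂ generalizing w₁ w₂
  · have h := this w₂ w₁ hw₂ hw₁ (le_of_not_ge hw)
    rw [abs_sub_comm] at h
    convert h using 3 with s
    rw [show (fun u => diagTrunc ψt u w₂ - diagTrunc ψt u w₁)
      = fun u => -(diagTrunc ψt u w₁ - diagTrunc ψt u w₂) by ext; abel, Kstar_neg, nnnorm_neg]
  set φ : ℝ → F := fun u => diagTrunc ψt u w₂ - diagTrunc ψt u w₁ with hφ
  have φ1 : ∀ u, 0 ≤ u → u < w₁ → φ u = ψt u w₂ - ψt u w₁ := fun u hu hu1 => by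
    simp only [hφ, diagTrunc]
    rw [indicator_of_mem (show u ∈ Ico 0 w₂ from ⟨hu, hu1.trans_le hw⟩),
      indicator_of_mem (show u ∈ Ico 0 w₁ from ⟨hu, hu1⟩)]
  have φ2 : ∀ u, w₁ ≤ u → u < w₂ → φ u = ψt u w₂ := fun u hu hu1 => by
    simp only [hφ, diagTrunc]
    rw [indicator_of_mem (show u ∈ Ico 0 w₂ from ⟨hw₁.1.trans hu, hu1⟩),
      indicator_of_notMem (fun h : u ∈ Ico 0 w₁ => absurd h.2 (not_lt.2 hu)), sub_zero]
  have φ3 : ∀ u, w₂ ≤ u → φ u = 0 := fun u hu => by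
    simp only [hφ, diagTrunc]
    rw [indicator_of_notMem (fun h : u ∈ Ico 0 w₂ => absurd h.2 (not_lt.2 hu)),
      indicator_of_notMem (fun h : u ∈ Ico 0 w₁ => absurd h.2 (not_lt.2 (hw.trans hu))),
      sub_zero]
  have hδ : 0 ≤ w₂ - w₁ := sub_nonneg.2 hw
  have hδabs : |w₂ - w₁| = w₂ - w₁ := abs_of_nonneg hδ
  have hleft : ∀ s, 0 < s → s < w₁ → ‖Kstar T K K' φ s‖ ≤
      A * (w₂ - w₁) ^ lam' * (s ^ (-(α + 1 / 4)) + (w₁ - s) ^ (-(α + 1 / 4))) := by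
    intro s hs hsw
    have hsI : s ∈ Icc 0 T := ⟨hs.le, hsw.le.trans hw₁.2⟩
    have hφs : ‖φ s‖ ≤ P * (w₂ - w₁) ^ lam := by
      rw [φ1 s hs.le hsw]
      have := (hψ s s w₁ w₂ hsI hsI hw₁ hw₂).2.1
      rw [hδabs] at this
      exact this.trans (by gcongr)
    refine le_trans (norm_Kstar_le_of_lt_left hα0 hlam hC hP
      (Real.rpow_nonneg hδ lam) hKC hs hsw hw hw₂.2 hφs ?_ ?_ ?_) (hA w₁ w₂ s hs hsw hw hw₂.2)
    · intro r hr hrw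
      have := (hψ s r w₁ w₂ hsI ⟨hs.le.trans hr.le, hrw.le.trans hw₁.2⟩ hw₁ hw₂).2.2
      rw [hδabs, abs_of_pos (sub_pos.2 hr)] at this
      have hrs := sub_pos.2 hr
      rw [φ1 s hs.le hsw, φ1 r (hs.le.trans hr.le) hrw,
        show ψt r w₂ - ψt r w₁ - (ψt s w₂ - ψt s w₁)
          = ψt s w₁ + ψt r w₂ - ψt s w₂ - ψt r w₁ by abel, mul_right_comm]
      exact this.trans (by gcongr)
    · intro r hr hrw
      rw [φ1 s hs.le hsw, φ2 r hr hrw]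
      have k1 := hM r ⟨hw₁.1.trans hr, hrw.le.trans hw₂.2⟩ w₂ hw₂
      have k2 := hM s hsI w₂ hw₂
      have k3 := hM s hsI w₁ hw₁
      have k4 := norm_sub_le (ψt r w₂) (ψt s w₂ - ψt s w₁)
      have k5 := norm_sub_le (ψt s w₂) (ψt s w₁)
      linarith
    · intro r hr _
      rwa [φ3 r hr, zero_sub, norm_neg]
  have hstrip : ∀ s, w₁ < s → s < w₂ → ‖Kstar T K K' φ s‖ ≤
      B * ((s - w₁) ^ (-(1 / 4) : ℝ) + (w₂ - s) ^ (-(1 / 4) : ℝ)) := by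
    intro s hsw hs
    have hs0 : 0 < s := hw₁.1.trans_lt hsw
    have hsI : s ∈ Icc 0 T := ⟨hs0.le, hs.le.trans hw₂.2⟩
    have hφs : ‖φ s‖ ≤ P := by
      rw [φ2 s hsw.le hs]
      linarith [hM s hsI w₂ hw₂]
    refine le_trans (norm_Kstar_le_of_mem_strip hα0 hα hlam hC hP hKC hs0 hs hw₂.2 hφs ?_ ?_)
      (hB w₁ w₂ s hw₁.1 hsw hs hw₂.2)
    · intro r hr hrw
      have := (hψ s r w₂ w₂ hsI ⟨hs0.le.trans hr.le, hrw.le.trans hw₂.2⟩ hw₂ hw₂).1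
      have hrs := sub_pos.2 hr
      rw [abs_of_pos hrs] at this
      rw [φ2 s hsw.le hs, φ2 r (hsw.le.trans hr.le) hrw]
      exact this.trans (by gcongr)
    · intro r hr _
      rwa [φ3 r hr, zero_sub, norm_neg]
  have hzero : ∀ s, w₂ ≤ s → Kstar T K K' φ s = 0 := by
    intro s hs
    rw [Kstar, φ3 s hs, smul_zero, zero_add]
    refine setIntegral_eq_zero_of_forall_eq_zero fun r hr => ?_
    simp [φ3 r (hs.trans hr.1.le)]
  refine (lintegral_sq_le_of_two_sided_bound (by linarith) (by norm_num) hw₁.1 hw hleft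
    hstrip hzero).trans ?_
  have hd2 : ((w₂ - w₁) ^ lam') ^ 2 = (w₂ - w₁) ^ (2 * lam') := by
    rw [← Real.rpow_natCast, ← Real.rpow_mul hδ]
    congr 1; push_cast; ring
  have hhalf : (w₂ - w₁) ^ (1 - 2 * (1 / 4) : ℝ) ≤
      T ^ (1 / 2 - 2 * lam') * (w₂ - w₁) ^ (2 * lam') := by
    rw [show (1 - 2 * (1 / 4) : ℝ) = 1 / 2 by norm_num]
    exact rpow_le_mul_rpow hδ (by linarith [hw₁.1, hw₂.2]) (by linarith) (by linarith)
  have hw₁0 := hw₁.1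
  have hw₁T : w₁ ^ (1 - 2 * (α + 1 / 4)) ≤ T ^ (1 - 2 * (α + 1 / 4)) :=
    Real.rpow_le_rpow hw₁.1 hw₁.2 hβ.le
  rw [← ENNReal.ofReal_add (by positivity) (by norm_num; positivity), hδabs]
  refine ENNReal.ofReal_le_ofReal ?_
  rw [mul_pow, hd2]
  calc _ ≤ 4 * (A ^ 2 * (w₂ - w₁) ^ (2 * lam')) *
        (T ^ (1 - 2 * (α + 1 / 4)) / (1 - 2 * (α + 1 / 4))) +
        4 * B ^ 2 * ((T ^ (1 / 2 - 2 * lam') * (w₂ - w₁) ^ (2 * lam')) /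
          (1 - 2 * (1 / 4))) := by
        gcongr
    _ = _ := by ring

end
end

section
/- Let F be a Banach space, K a Volterra kernel on [0,T]² satisfying Condition (A) with parameter α∈[0,1/4), and ψ(u,v)=𝟙_{[0,v)}(u)·ψ̃(u,v) with ψ̃:[0,T]²→F strongly λ-Hölder bi-continuous in the norm of F, λ>α; set λ' := min(λ,1/4). Then there exists C'<∞ such that for every w∈[0,T]: K*(ψ(·,w))(s)=0 for s≥w, and ||K*(ψ(·,w))(s)||_F ≤ C'( s^{−α}(w−s)^{−α} + (w−s)^{λ'−α} ) for all 0<s<w. Consequently, for every p∈[1,4], sup_{w∈[0,T]} ∫_0^T ||K*(ψ(·,w))(s)||_F^p ds < ∞. -/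
open MeasureTheory Set

noncomputable section

/-- The constant in Condition (A) can be taken nonnegative. -/
lemma VolterraCondA.exists_nonneg {T : ℝ} {K K' : ℝ → ℝ → ℝ} {α : ℝ}
    (hK : VolterraCondA T K K' α) :
    ∃ C : ℝ, 0 ≤ C ∧ ∀ s t : ℝ, 0 < s → s < t → t ≤ T →
      |K t s| ≤ C * s ^ (-α) * (t - s) ^ (-α) ∧
      HasDerivAt (fun r => K r s) (K' t s) t ∧
      |K' t s| ≤ C * (t - s) ^ (-(α + 1)) := by
  obtain ⟨-, -, C, hC⟩ := hK
  refine ⟨|C|, abs_nonneg C, fun s t hs hst ht => ?_⟩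
  obtain ⟨h₁, h₂, h₃⟩ := hC s t hs hst ht
  have hts : 0 < t - s := sub_pos.2 hst
  refine ⟨h₁.trans ?_, h₂, h₃.trans ?_⟩ <;> gcongr <;> exact le_abs_self C

/-- A bi-Hölder function is bounded on the square, and Hölder continuous in its first variable. -/
lemma StronglyHolderBi.exists_bound {E : Type*} [NormedAddCommGroup E] {T lam : ℝ} (hT : 0 ≤ T)
    (hlam : 0 ≤ lam) {ψ : ℝ → ℝ → E} (hψ : StronglyHolderBi T lam ψ) :
    ∃ H : ℝ, 0 ≤ H ∧ (∀ u ∈ Icc 0 T, ∀ v ∈ Icc 0 T, ‖ψ u v‖ ≤ H) ∧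
      ∀ u₁ ∈ Icc 0 T, ∀ u₂ ∈ Icc 0 T, ∀ v ∈ Icc 0 T, ‖ψ u₂ v - ψ u₁ v‖ ≤ H * |u₂ - u₁| ^ lam := by
  obtain ⟨C, hC⟩ := hψ
  have h0 : (0 : ℝ) ∈ Icc 0 T := ⟨le_rfl, hT⟩
  have hpow : ∀ u ∈ Icc 0 T, C * |u - 0| ^ lam ≤ |C| * T ^ lam := fun u hu => by
    rw [sub_zero, abs_of_nonneg hu.1]
    have hu1 := hu.1
    have hu2 := hu.2
    gcongr
    exact le_abs_self C
  refine ⟨|C| + (‖ψ 0 0‖ + |C| * T ^ lam + |C| * T ^ lam), by positivity, fun u hu v hv => ?_,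
    fun u₁ hu₁ u₂ hu₂ v hv => ?_⟩
  · have h₁ := (hC 0 u v v h0 hu hv hv).1.trans (hpow u hu)
    have h₂ := (hC 0 0 0 v h0 h0 h0 hv).2.1.trans (hpow v hv)
    have h₃ := norm_le_norm_add_norm_sub' (ψ u v) (ψ 0 v)
    have h₄ := norm_le_norm_add_norm_sub' (ψ 0 v) (ψ 0 0)
    linarith [abs_nonneg C]
  · refine (hC u₁ u₂ v v hu₁ hu₂ hv hv).1.trans ?_
    gcongr
    have : 0 ≤ ‖ψ 0 0‖ + |C| * T ^ lam + |C| * T ^ lam := by positivity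
    linarith [le_abs_self C]

lemma intervalIntegrable_sub_rpow {a s b β : ℝ} (ha : s < a) (hb : a ≤ b) :
    IntervalIntegrable (fun r => (r - s) ^ β) volume a b := by
  refine ContinuousOn.intervalIntegrable fun r hr => ?_
  rw [uIcc_of_le hb] at hr
  exact ((continuousAt_id.sub continuousAt_const).rpow_const
    (Or.inl (sub_pos.2 (ha.trans_le hr.1)).ne')).continuousWithinAt

lemma aestronglyMeasurable_of_hasDerivAt {F : Type*} [NormedAddCommGroup F] [NormedSpace ℝ F]
    [CompleteSpace F] {S : Set ℝ} (hS : MeasurableSet S) {f f' : ℝ → F}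
    (h : ∀ x ∈ S, HasDerivAt f (f' x) x) : AEStronglyMeasurable f' (volume.restrict S) :=
  (aestronglyMeasurable_deriv f _).congr <|
    (ae_restrict_mem hS).mono fun x hx => (h x hx).deriv

section Kernel

variable {E : Type*} [NormedAddCommGroup E] [NormedSpace ℝ E]
  {T α C : ℝ} {K K' : ℝ → ℝ → ℝ}

lemma intervalIntegrable_kernel_deriv
    (hC : ∀ s t : ℝ, 0 < s → s < t → t ≤ T → |K t s| ≤ C * s ^ (-α) * (t - s) ^ (-α) ∧
      HasDerivAt (fun r => K r s) (K' t s) t ∧ |K' t s| ≤ C * (t - s) ^ (-(α + 1)))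
    {s w : ℝ} (hs : 0 < s) (hsw : s < w) (hwT : w ≤ T) :
    IntervalIntegrable (fun r => K' r s) volume w T := by
  have hg := (intervalIntegrable_sub_rpow (β := -(α + 1)) hsw hwT).const_mul C
  rw [intervalIntegrable_iff_integrableOn_Ioc_of_le hwT] at hg ⊢
  refine Integrable.mono' hg (aestronglyMeasurable_of_hasDerivAt measurableSet_Ioc
    fun r hr => (hC s r hs (hsw.trans hr.1) hr.2).2.1) ?_
  exact (ae_restrict_mem measurableSet_Ioc).mono fun r hr =>
    (hC s r hs (hsw.trans hr.1) hr.2).2.2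

lemma integral_kernel_deriv
    (hC : ∀ s t : ℝ, 0 < s → s < t → t ≤ T → |K t s| ≤ C * s ^ (-α) * (t - s) ^ (-α) ∧
      HasDerivAt (fun r => K r s) (K' t s) t ∧ |K' t s| ≤ C * (t - s) ^ (-(α + 1)))
    {s w : ℝ} (hs : 0 < s) (hsw : s < w) (hwT : w ≤ T) :
    ∫ r in w..T, K' r s = K T s - K w s := by
  refine intervalIntegral.integral_eq_sub_of_hasDerivAt (f := fun r => K r s) (fun r hr => ?_)
    (intervalIntegrable_kernel_deriv hC hs hsw hwT)
  rw [uIcc_of_le hwT] at hr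
  exact (hC s r hs (hsw.trans_le hr.1) hr.2).2.1

/-- Separating the two singularities of the kernel: the product in Condition (A) can be replaced
by a sum. -/
lemma exists_kernel_sum_bound (hT : 0 < T) (hα : 0 ≤ α) (hC0 : 0 ≤ C)
    (hC : ∀ s t : ℝ, 0 < s → s < t → t ≤ T → |K t s| ≤ C * s ^ (-α) * (t - s) ^ (-α) ∧
      HasDerivAt (fun r => K r s) (K' t s) t ∧ |K' t s| ≤ C * (t - s) ^ (-(α + 1))) :
    ∃ D : ℝ, 0 ≤ D ∧ ∀ s w : ℝ, 0 < s → s < w → w ≤ T →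
      |K w s| ≤ D * (s ^ (-α) + (w - s) ^ (-α)) := by
  rcases hα.eq_or_lt with rfl | hα
  · refine ⟨C, hC0, fun s w hs hsw hwT => (hC s w hs hsw hwT).1.trans ?_⟩
    simp only [neg_zero, Real.rpow_zero]
    linarith
  have hB : 0 < (T / 2) ^ (-α) := by positivity
  refine ⟨C * (T / 2) ^ (-α) + C / α, by positivity, fun s w hs hsw hwT => ?_⟩
  have hws : 0 < w - s := sub_pos.2 hsw
  have ha : 0 < s ^ (-α) := by positivity
  have hb : 0 < (w - s) ^ (-α) := by positivity
  have hanti : ∀ x, T / 2 ≤ x → x ^ (-α) ≤ (T / 2) ^ (-α) := fun x hx =>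
    Real.rpow_le_rpow_of_nonpos (by positivity) hx (by linarith)
  have hexp : (C * (T / 2) ^ (-α) + C / α) * (s ^ (-α) + (w - s) ^ (-α)) =
      C * s ^ (-α) * (T / 2) ^ (-α) + C * (T / 2) ^ (-α) * (w - s) ^ (-α)
        + C / α * s ^ (-α) + C / α * (w - s) ^ (-α) := by ring
  have p₁ : 0 ≤ C * s ^ (-α) * (T / 2) ^ (-α) := by positivity
  have p₂ : 0 ≤ C * (T / 2) ^ (-α) * (w - s) ^ (-α) := by positivity
  have p₃ : 0 ≤ C / α * s ^ (-α) := by positivity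
  have p₄ : 0 ≤ C / α * (w - s) ^ (-α) := by positivity
  rw [hexp]
  rcases le_total (T / 2) s with hsT | hsT
  · have h : C * s ^ (-α) * (w - s) ^ (-α) ≤ C * (T / 2) ^ (-α) * (w - s) ^ (-α) := by
      gcongr ?_ * _
      exact mul_le_mul_of_nonneg_left (hanti s hsT) hC0
    linarith [(hC s w hs hsw hwT).1]
  · have h₁ : |K T s| ≤ C * s ^ (-α) * (T / 2) ^ (-α) := by
      refine (hC s T hs (hsw.trans_le hwT) le_rfl).1.trans ?_
      exact mul_le_mul_of_nonneg_left (hanti _ (by linarith)) (by positivity)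
    have h₂ : |∫ r in w..T, K' r s| ≤ ∫ r in w..T, C * (r - s) ^ (-(α + 1)) := by
      rw [← Real.norm_eq_abs]
      refine intervalIntegral.norm_integral_le_of_norm_le hwT (ae_of_all _ fun r hr => ?_)
        ((intervalIntegrable_sub_rpow hsw hwT).const_mul C)
      exact (hC s r hs (hsw.trans hr.1) hr.2).2.2
    have h₃ : ∫ r in w..T, C * (r - s) ^ (-(α + 1)) =
        C / α * ((w - s) ^ (-α) - (T - s) ^ (-α)) := by
      rw [intervalIntegral.integral_const_mul,
        intervalIntegral.integral_comp_sub_right (fun x => x ^ (-(α + 1))), integral_rpow]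
      · rw [show -(α + 1) + 1 = -α by ring]
        field_simp
        ring
      · refine Or.inr ⟨by linarith, ?_⟩
        rw [uIcc_of_le (by linarith)]
        exact fun h => hws.not_ge h.1
    rw [h₃, integral_kernel_deriv hC hs hsw hwT] at h₂
    have p₅ : 0 ≤ C / α * (T - s) ^ (-α) := by
      have : 0 ≤ T - s := by linarith
      positivity
    have h₄ : |K w s| ≤ |K T s| + |K T s - K w s| := by
      have := abs_sub_abs_le_abs_sub (K w s) (K T s)
      rw [abs_sub_comm (K w s)] at this
      linarith
    linarith

lemma Kstar_diagTrunc_of_le {s w : ℝ} (hws : w ≤ s) (ψ : ℝ → ℝ → E) :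
    Kstar T K K' (fun u => diagTrunc ψ u w) s = 0 := by
  have h : ∀ u, w ≤ u → diagTrunc ψ u w = 0 := fun u hu =>
    indicator_of_notMem (fun hu' => hu.not_gt hu'.2) _
  rw [Kstar, h s hws, smul_zero, zero_add]
  refine setIntegral_eq_zero_of_forall_eq_zero fun r hr => ?_
  rw [h r (hws.trans hr.1.le), sub_zero, smul_zero]

/-- Pointwise bound for `K*` on a truncated Hölder function. -/
lemma norm_Kstar_diagTrunc_le {lam H : ℝ} [CompleteSpace E] (hlam : α < lam) (hlam0 : 0 < lam)
    (hC0 : 0 ≤ C)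
    (hC : ∀ s t : ℝ, 0 < s → s < t → t ≤ T → |K t s| ≤ C * s ^ (-α) * (t - s) ^ (-α) ∧
      HasDerivAt (fun r => K r s) (K' t s) t ∧ |K' t s| ≤ C * (t - s) ^ (-(α + 1)))
    {ψ : ℝ → ℝ → E} (hH : ∀ u ∈ Icc 0 T, ∀ v ∈ Icc 0 T, ‖ψ u v‖ ≤ H)
    (hψ : ∀ u₁ ∈ Icc 0 T, ∀ u₂ ∈ Icc 0 T, ∀ v ∈ Icc 0 T,
      ‖ψ u₂ v - ψ u₁ v‖ ≤ H * |u₂ - u₁| ^ lam)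
    {s w : ℝ} (hs : 0 < s) (hsw : s < w) (hwT : w ≤ T) :
    ‖Kstar T K K' (fun u => diagTrunc ψ u w) s‖ ≤
      |K w s| * H + C * H / (lam - α) * (w - s) ^ (lam - α) := by
  have hwmem : w ∈ Icc 0 T := ⟨(hs.trans hsw).le, hwT⟩
  have hsmem : s ∈ Icc 0 T := ⟨hs.le, hsw.le.trans hwT⟩
  have hin : ∀ u, 0 ≤ u → u < w → diagTrunc ψ u w = ψ u w := fun u h0 hu =>
    indicator_of_mem (show u ∈ Ico 0 w from ⟨h0, hu⟩) _
  have hout : ∀ u, w ≤ u → diagTrunc ψ u w = 0 := fun u hu =>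
    indicator_of_notMem (fun hu' => hu.not_gt hu'.2) _
  have hcont : ContinuousOn (fun r => ψ r w) (Icc 0 T) := by
    intro x hx
    rw [ContinuousWithinAt, tendsto_iff_norm_sub_tendsto_zero]
    have hlim : Filter.Tendsto (fun r : ℝ => H * |r - x| ^ lam) (nhdsWithin x (Icc 0 T))
        (nhds 0) := by
      have : Continuous fun r : ℝ => H * |r - x| ^ lam :=
        continuous_const.mul ((continuous_id.sub continuous_const).abs.rpow_const
          fun _ => Or.inr hlam0.le)
      have h := (this.tendsto x).mono_left (nhdsWithin_le_nhds (s := Icc 0 T))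
      simpa [Real.zero_rpow hlam0.ne'] using h
    refine squeeze_zero' (Filter.Eventually.of_forall fun _ => norm_nonneg _) ?_ hlim
    filter_upwards [self_mem_nhdsWithin] with r hr using hψ x hx r hr w hwmem
  have hg : IntervalIntegrable (fun r => C * H * (r - s) ^ (lam - α - 1)) volume s w := by
    have := (intervalIntegral.intervalIntegrable_rpow' (a := 0) (b := w - s)
      (show -1 < lam - α - 1 by linarith)).comp_sub_right s
    simpa using this.const_mul (C * H)
  have hle : ∀ r ∈ Ioc s w, ‖K' r s • (ψ r w - ψ s w)‖ ≤ C * H * (r - s) ^ (lam - α - 1) := by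
    intro r hr
    have hrs : 0 < r - s := sub_pos.2 hr.1
    have h₁ := (hC s r hs hr.1 (hr.2.trans hwT)).2.2
    have h₂ := hψ s hsmem r ⟨(hs.trans hr.1).le, hr.2.trans hwT⟩ w hwmem
    rw [abs_of_pos hrs] at h₂
    rw [norm_smul, Real.norm_eq_abs]
    calc |K' r s| * ‖ψ r w - ψ s w‖
        ≤ (C * (r - s) ^ (-(α + 1))) * (H * (r - s) ^ lam) := by gcongr
      _ = C * H * ((r - s) ^ (-(α + 1)) * (r - s) ^ lam) := by ring
      _ = C * H * (r - s) ^ (lam - α - 1) := by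
          rw [← Real.rpow_add hrs]
          congr 2
          ring
  have hint₁ : IntegrableOn (fun r => K' r s • (ψ r w - ψ s w)) (Ioc s w) := by
    rw [intervalIntegrable_iff_integrableOn_Ioc_of_le hsw.le] at hg
    refine Integrable.mono' hg (AEStronglyMeasurable.smul
      (aestronglyMeasurable_of_hasDerivAt measurableSet_Ioc fun r hr =>
        (hC s r hs hr.1 (hr.2.trans hwT)).2.1) ?_)
      ((ae_restrict_mem measurableSet_Ioc).mono hle)
    exact ((hcont.mono fun r hr => ⟨(hs.trans hr.1).le, hr.2.trans hwT⟩).sub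
      continuousOn_const).aestronglyMeasurable measurableSet_Ioc
  have hint₂ : IntegrableOn (fun r => K' r s • (-ψ s w)) (Icc w T) := by
    rw [integrableOn_Icc_iff_integrableOn_Ioc]
    have := intervalIntegrable_kernel_deriv hC hs hsw hwT
    rw [intervalIntegrable_iff_integrableOn_Ioc_of_le hwT] at this
    exact this.smul_const _
  have heq₁ : EqOn (fun r => K' r s • (diagTrunc ψ r w - diagTrunc ψ s w))
      (fun r => K' r s • (ψ r w - ψ s w)) (Ioo s w) := fun r hr => by
    simp only [hin s hs.le hsw, hin r (hs.trans hr.1).le hr.2]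
  have heq₂ : EqOn (fun r => K' r s • (diagTrunc ψ r w - diagTrunc ψ s w))
      (fun r => K' r s • (-ψ s w)) (Icc w T) := fun r hr => by
    simp only [hin s hs.le hsw, hout r hr.1, zero_sub]
  have hrep : Kstar T K K' (fun u => diagTrunc ψ u w) s =
      K w s • ψ s w + ∫ r in s..w, K' r s • (ψ r w - ψ s w) := by
    have h₂ : ∫ r in Icc w T, K' r s • (-ψ s w) = (K T s - K w s) • (-ψ s w) := by
      rw [integral_smul_const, integral_Icc_eq_integral_Ioc,
        ← intervalIntegral.integral_of_le hwT, integral_kernel_deriv hC hs hsw hwT]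
    rw [Kstar, ← Ioo_union_Icc_eq_Ioc hsw hwT, setIntegral_union
      (disjoint_left.2 fun r h h' => h.2.not_ge h'.1) measurableSet_Icc
      ((integrableOn_congr_fun heq₁ measurableSet_Ioo).2
        (hint₁.mono_set Ioo_subset_Ioc_self))
      ((integrableOn_congr_fun heq₂ measurableSet_Icc).2 hint₂),
      setIntegral_congr_fun measurableSet_Ioo heq₁, setIntegral_congr_fun measurableSet_Icc heq₂,
      h₂, hin s hs.le hsw, intervalIntegral.integral_of_le hsw.le, integral_Ioc_eq_integral_Ioo]
    module
  have hval : ∫ r in s..w, C * H * (r - s) ^ (lam - α - 1) =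
      C * H / (lam - α) * (w - s) ^ (lam - α) := by
    rw [intervalIntegral.integral_const_mul,
      intervalIntegral.integral_comp_sub_right (fun x => x ^ (lam - α - 1)),
      integral_rpow (Or.inl (by linarith)), sub_self, sub_add_cancel,
      Real.zero_rpow (by linarith)]
    ring
  rw [hrep, ← hval]
  refine (norm_add_le _ _).trans (add_le_add ?_
    (intervalIntegral.norm_integral_le_of_norm_le hsw.le (ae_of_all _ hle) hg))
  rw [norm_smul, Real.norm_eq_abs]
  gcongr
  exact hH s hsmem w hwmem

end Kernel

lemma rpow_le_rpow_mul_rpow_sub {x T a b : ℝ} (hx : 0 < x) (hxT : x ≤ T) (hab : b ≤ a) :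
    x ^ a ≤ T ^ (a - b) * x ^ b := by
  rw [← sub_add_cancel a b, Real.rpow_add hx, add_sub_cancel_right]
  gcongr

/-- A uniform `L^p` bound, `0 < p ≤ 4`, for functions dominated by integrable power singularities at
both ends of `(0, w)`. -/
lemma lintegral_rpow_le_of_endpoint_bound {E : Type*} [NormedAddCommGroup E] {T α A p : ℝ}
    (hα : α < 1 / 4) (hA : 0 ≤ A) (hp0 : 0 < p) (hp : p ≤ 4) {w : ℝ}
    (hw : w ∈ Icc 0 T) {f : ℝ → E} (hzero : ∀ s, w ≤ s → f s = 0)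
    (hf : ∀ s, 0 < s → s < w → ‖f s‖ ≤ A * (s ^ (-α) + (w - s) ^ (-α) + 1)) :
    ∫⁻ s in Icc (0:ℝ) T, (‖f s‖₊ : ENNReal) ^ p ≤
      ENNReal.ofReal (T + 27 * A ^ 4 * (2 * (T ^ (1 - 4 * α) / (1 - 4 * α)) + T)) := by
  set g : ℝ → ℝ := fun s => 1 + 27 * A ^ 4 * (s ^ (-(4 * α)) + (w - s) ^ (-(4 * α)) + 1) with hg
  have hg0 : ∀ s ∈ Ioo 0 w, 0 ≤ g s := fun s hs => by
    have h₁ := hs.1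
    have h₂ : 0 < w - s := sub_pos.2 hs.2
    positivity
  have hfg : ∀ s ∈ Ioo 0 w, ‖f s‖ ^ p ≤ g s := by
    intro s hs
    have hs0 := hs.1
    have hws : 0 < w - s := sub_pos.2 hs.2
    have hpow : ∀ x : ℝ, 0 < x → (x ^ (-α)) ^ 4 = x ^ (-(4 * α)) := fun x hx => by
      rw [← Real.rpow_natCast, ← Real.rpow_mul hx.le]
      congr 1
      push_cast
      ring
    have h₁ : ‖f s‖ ^ p ≤ 1 + ‖f s‖ ^ 4 := by
      have h4 : 0 ≤ ‖f s‖ ^ 4 := by positivity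
      rcases le_total ‖f s‖ 1 with h | h
      · linarith [Real.rpow_le_one (norm_nonneg (f s)) h hp0.le]
      · have := Real.rpow_le_rpow_of_exponent_le h hp
        rw [show (4 : ℝ) = ((4 : ℕ) : ℝ) by norm_num, Real.rpow_natCast] at this
        linarith
    have h₂ : ‖f s‖ ^ 4 ≤ (A * (s ^ (-α) + (w - s) ^ (-α) + 1)) ^ 4 := by
      gcongr
      exact hf s hs0 hs.2
    have h₃ : ∀ a b : ℝ, (a + b + 1) ^ 4 ≤ 27 * (a ^ 4 + b ^ 4 + 1) := fun a b => by
      have e₁ : (a + b + 1) ^ 2 ≤ 3 * (a ^ 2 + b ^ 2 + 1) := by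
        nlinarith [sq_nonneg (a - b), sq_nonneg (a - 1), sq_nonneg (b - 1)]
      have e₂ : (a ^ 2 + b ^ 2 + 1) ^ 2 ≤ 3 * (a ^ 4 + b ^ 4 + 1) := by
        nlinarith [sq_nonneg (a ^ 2 - b ^ 2), sq_nonneg (a ^ 2 - 1), sq_nonneg (b ^ 2 - 1)]
      have e₃ := pow_le_pow_left₀ (sq_nonneg (a + b + 1)) e₁ 2
      nlinarith
    have h₄ := mul_le_mul_of_nonneg_left (h₃ (s ^ (-α)) ((w - s) ^ (-α))) (pow_nonneg hA 4)
    rw [hpow s hs0, hpow _ hws] at h₄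
    rw [mul_pow] at h₂
    simp only [hg]
    linarith
  have hexp : -1 < -(4 * α) := by linarith
  have hi₁ : IntervalIntegrable (fun s : ℝ => s ^ (-(4 * α))) volume 0 w :=
    intervalIntegral.intervalIntegrable_rpow' hexp
  have hi₂ : IntervalIntegrable (fun s : ℝ => (w - s) ^ (-(4 * α))) volume 0 w := by
    simpa using (hi₁.comp_sub_left w).symm
  have hgi : IntervalIntegrable g volume 0 w :=
    intervalIntegrable_const.add (((hi₁.add hi₂).add intervalIntegrable_const).const_mul _)
  have hval : ∫ s in (0:ℝ)..w, g s =
      w + 27 * A ^ 4 * (2 * (w ^ (1 - 4 * α) / (1 - 4 * α)) + w) := by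
    have hv : ∫ s in (0:ℝ)..w, s ^ (-(4 * α)) = w ^ (1 - 4 * α) / (1 - 4 * α) := by
      rw [integral_rpow (Or.inl hexp), show -(4 * α) + 1 = 1 - 4 * α by ring,
        Real.zero_rpow (by linarith), sub_zero]
    simp only [hg]
    rw [intervalIntegral.integral_add intervalIntegrable_const
        (((hi₁.add hi₂).add intervalIntegrable_const).const_mul _),
      intervalIntegral.integral_const_mul,
      intervalIntegral.integral_add (hi₁.add hi₂) intervalIntegrable_const,
      intervalIntegral.integral_add hi₁ hi₂,
      intervalIntegral.integral_comp_sub_left (fun x : ℝ => x ^ (-(4 * α))), sub_self, sub_zero,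
      hv, intervalIntegral.integral_const]
    simp only [smul_eq_mul, mul_one, sub_zero]
    ring
  calc ∫⁻ s in Icc (0:ℝ) T, (‖f s‖₊ : ENNReal) ^ p
      ≤ ∫⁻ s in Ioc (0:ℝ) T, (Ioo 0 w).indicator (fun s => ENNReal.ofReal (g s)) s := by
        rw [setLIntegral_congr Ioc_ae_eq_Icc.symm]
        refine setLIntegral_mono' measurableSet_Ioc fun s hs => ?_
        by_cases hsw : s < w
        · rw [indicator_of_mem (show s ∈ Ioo 0 w from ⟨hs.1, hsw⟩), ← enorm_eq_nnnorm,
            ← ofReal_norm, ENNReal.ofReal_rpow_of_nonneg (norm_nonneg _) hp0.le]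
          exact ENNReal.ofReal_le_ofReal (hfg s ⟨hs.1, hsw⟩)
        · simp [hzero s (not_lt.1 hsw), hp0]
    _ ≤ ∫⁻ s, (Ioo 0 w).indicator (fun s => ENNReal.ofReal (g s)) s := setLIntegral_le_lintegral _ _
    _ = ENNReal.ofReal (∫ s in (0:ℝ)..w, g s) := by
        rw [lintegral_indicator measurableSet_Ioo, intervalIntegral.integral_of_le hw.1,
          integral_Ioc_eq_integral_Ioo, ofReal_integral_eq_lintegral_ofReal]
        · exact ((intervalIntegrable_iff_integrableOn_Ioc_of_le hw.1).1 hgi).mono_set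
            Ioo_subset_Ioc_self
        · exact (ae_restrict_mem measurableSet_Ioo).mono hg0
    _ ≤ _ := by
        rw [hval]
        have h₁ := hw.1
        have h₂ := hw.2
        have h₃ : 0 < 1 - 4 * α := by linarith
        gcongr

/-- Pointwise bounds and uniform `L^p` bounds for `K*(ψ(·,w))`:  the function vanishes for
`s ≥ w`, is bounded by `C'(s^{−α}(w−s)^{−α} + (w−s)^{λ'−α})` for `0 < s < w` with
`λ' = min(λ,1/4)`, and consequently `sup_{w∈[0,T]} ∫_0^T ‖K*(ψ(·,w))(s)‖^p ds < ∞` for all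
`p ∈ [1,4]`. -/
theorem Kstar_column_pointwise_and_Lp_bounds
    {E : Type*} [NormedAddCommGroup E] [NormedSpace ℝ E] [CompleteSpace E]
    (T : ℝ) (hT : 0 < T) (K K' : ℝ → ℝ → ℝ) (α : ℝ) (hα0 : 0 ≤ α) (hα : α < 1 / 4)
    (hK : VolterraCondA T K K' α)
    (lam : ℝ) (hlam : α < lam)
    (ψt : ℝ → ℝ → E) (hψt : StronglyHolderBi T lam ψt) :
    (∀ w ∈ Icc (0:ℝ) T, ∀ s ∈ Icc (0:ℝ) T, w ≤ s →
        Kstar T K K' (fun u => diagTrunc ψt u w) s = 0) ∧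
    (∃ C' : ℝ, ∀ w ∈ Icc (0:ℝ) T, ∀ s : ℝ, 0 < s → s < w →
        ‖Kstar T K K' (fun u => diagTrunc ψt u w) s‖
          ≤ C' * (s ^ (-α) * (w - s) ^ (-α) + (w - s) ^ (min lam (1 / 4) - α))) ∧
    (∀ p : ℝ, 1 ≤ p → p ≤ 4 →
      ∃ M : ℝ, ∀ w ∈ Icc (0:ℝ) T,
        ∫⁻ s in Icc (0:ℝ) T,
            (‖Kstar T K K' (fun u => diagTrunc ψt u w) s‖₊ : ENNReal) ^ p
          ≤ ENNReal.ofReal M) := by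
  obtain ⟨C, hC0, hC⟩ := hK.exists_nonneg
  have hlam0 : 0 < lam := hα0.trans_lt hlam
  obtain ⟨H, hH0, hH, hψ⟩ := hψt.exists_bound hT.le hlam0.le
  have hbound := fun s w hs hsw hwT =>
    norm_Kstar_diagTrunc_le (E := E) hlam hlam0 hC0 hC hH hψ (s := s) (w := w) hs hsw hwT
  have hd : 0 < lam - α := sub_pos.2 hlam
  refine ⟨fun w _ s _ hws => Kstar_diagTrunc_of_le hws ψt, ?_, fun p hp1 hp4 => ?_⟩
  · refine ⟨C * H + C * H / (lam - α) * T ^ (lam - min lam (1 / 4)), fun w hw s hs hsw => ?_⟩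
    have hws : 0 < w - s := sub_pos.2 hsw
    have h₁ := mul_le_mul_of_nonneg_right (hC s w hs hsw hw.2).1 hH0
    have h₂ := rpow_le_rpow_mul_rpow_sub (T := T) (a := lam - α) (b := min lam (1 / 4) - α) hws
      (by linarith [hw.2]) (by linarith [min_le_left lam (1 / 4)])
    rw [sub_sub_sub_cancel_right] at h₂
    have h₃ := mul_le_mul_of_nonneg_left h₂ (show 0 ≤ C * H / (lam - α) by positivity)
    have p₁ : 0 ≤ C * H * (w - s) ^ (min lam (1 / 4) - α) := by positivity
    have p₂ : 0 ≤ C * H / (lam - α) * T ^ (lam - min lam (1 / 4)) *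
      (s ^ (-α) * (w - s) ^ (-α)) := by positivity
    refine (hbound s w hs hsw hw.2).trans ?_
    linarith
  · obtain ⟨D, hD0, hD⟩ := exists_kernel_sum_bound hT hα0 hC0 hC
    refine ⟨_, fun w hw => lintegral_rpow_le_of_endpoint_bound
      (A := D * H + C * H / (lam - α) * T ^ (lam - α)) hα (by positivity)
      (by linarith) hp4 hw (fun s hws => Kstar_diagTrunc_of_le hws ψt)
      (fun s hs hsw => (hbound s w hs hsw hw.2).trans ?_)⟩
    have hws : 0 < w - s := sub_pos.2 hsw
    have h₁ := mul_le_mul_of_nonneg_right (hD s w hs hsw hw.2) hH0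
    have h₂ : C * H / (lam - α) * (w - s) ^ (lam - α) ≤
        C * H / (lam - α) * T ^ (lam - α) := by
      gcongr
      linarith [hw.2]
    have p₁ : 0 ≤ C * H / (lam - α) * T ^ (lam - α) * (s ^ (-α) + (w - s) ^ (-α)) := by
      positivity
    have p₂ : 0 ≤ D * H := by positivity
    linarith

end
end

section
/- (Coboundary identity.) Let (x,X²,X³) satisfy Chen's relations on [0,T], and let (φ,φ',φ'') with φ:[0,T]→L(ℝ^d;ℝ^e), φ':[0,T]→L(ℝ^d⊗ℝ^d;ℝ^e), φ'':[0,T]→L(ℝ^d⊗ℝ^d⊗ℝ^d;ℝ^e) satisfy φ_{s,t}=φ'_s x_{s,t}+φ''_s X²_{s,t}+R^φ_{s,t} and φ'_{s,t}=φ''_s x_{s,t}+R^{φ'}_{s,t} for all s≤t. Define Ξ_{s,t} := φ_s(x_{s,t}) + φ'_s(X²_{s,t}) + φ''_s(X³_{s,t}). Then for all 0≤s≤u≤t≤T: Ξ_{s,u} + Ξ_{u,t} − Ξ_{s,t} = R^φ_{s,u}(x_{u,t}) + R^{φ'}_{s,u}(X²_{u,t}) + φ''_{s,u}(X³_{u,t}),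 where φ''_{s,u} := φ''_u − φ''_s. -/
open Finset

noncomputable section

/-- The local approximation
`Ξ_{s,t} := φ_s(x_{s,t}) + φ'_s(X²_{s,t}) + φ''_s(X³_{s,t})`, in coordinates
(`φ_t` represents an element of `L(ℝ^d;ℝ^e)` via `φ t i = φ_t(e_i)`, and similarly for
`φ'`, `φ''`). -/
def roughXi {d e : ℕ} (x : ℝ → Fin d → ℝ) (X2 : ℝ → ℝ → Fin d → Fin d → ℝ)
    (X3 : ℝ → ℝ → Fin d → Fin d → Fin d → ℝ)
    (φ : ℝ → Fin d → Fin e → ℝ) (φ' : ℝ → Fin d → Fin d → Fin e → ℝ)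
    (φ'' : ℝ → Fin d → Fin d → Fin d → Fin e → ℝ) (s t : ℝ) : Fin e → ℝ :=
  (∑ i, (x t i - x s i) • φ s i) + (∑ i, ∑ j, X2 s t i j • φ' s i j)
    + ∑ i, ∑ j, ∑ k, X3 s t i j k • φ'' s i j k

/-- **Coboundary identity.**  If `(x,X²,X³)` satisfies Chen's relations on `[0,T]` and
`(φ,φ',φ'')` satisfies the controlled-path decompositions with remainders `R^φ`, `R^{φ'}`,
then for all `0 ≤ s ≤ u ≤ t ≤ T`:
`Ξ_{s,u} + Ξ_{u,t} − Ξ_{s,t} = R^φ_{s,u}(x_{u,t}) + R^{φ'}_{s,u}(X²_{u,t}) + φ''_{s,u}(X³_{u,t})`. -/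
theorem roughXi_coboundary
    {d e : ℕ} (T : ℝ)
    (x : ℝ → Fin d → ℝ) (X2 : ℝ → ℝ → Fin d → Fin d → ℝ)
    (X3 : ℝ → ℝ → Fin d → Fin d → Fin d → ℝ)
    (hChen : ∀ s u t : ℝ, 0 ≤ s → s ≤ u → u ≤ t → t ≤ T →
      (∀ i j, X2 s t i j = X2 s u i j + X2 u t i j + (x u i - x s i) * (x t j - x u j)) ∧
      (∀ i j k, X3 s t i j k = X3 s u i j k + X3 u t i j k
          + X2 s u i j * (x t k - x u k) + (x u i - x s i) * X2 u t j k))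
    (φ : ℝ → Fin d → Fin e → ℝ) (φ' : ℝ → Fin d → Fin d → Fin e → ℝ)
    (φ'' : ℝ → Fin d → Fin d → Fin d → Fin e → ℝ)
    (Rφ : ℝ → ℝ → Fin d → Fin e → ℝ) (Rφ' : ℝ → ℝ → Fin d → Fin d → Fin e → ℝ)
    (hφ : ∀ s t : ℝ, 0 ≤ s → s ≤ t → t ≤ T →
      φ t - φ s = (∑ i, (x t i - x s i) • φ' s i)
        + (∑ i, ∑ j, X2 s t i j • φ'' s i j) + Rφ s t)
    (hφ' : ∀ s t : ℝ, 0 ≤ s → s ≤ t → t ≤ T →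
      φ' t - φ' s = (fun j => ∑ i, (x t i - x s i) • φ'' s i j) + Rφ' s t) :
    ∀ s u t : ℝ, 0 ≤ s → s ≤ u → u ≤ t → t ≤ T →
      roughXi x X2 X3 φ φ' φ'' s u + roughXi x X2 X3 φ φ' φ'' u t
          - roughXi x X2 X3 φ φ' φ'' s t
        = (∑ j, (x t j - x u j) • Rφ s u j)
          + (∑ j, ∑ k, X2 u t j k • Rφ' s u j k)
          + ∑ j, ∑ k, ∑ l, X3 u t j k l • (φ'' u j k l - φ'' s j k l) := by
  intro s u t hs hsu hut htT
  have hRφ : ∀ j, Rφ s u j = φ u j - φ s j - (∑ i, (x u i - x s i) • φ' s i j)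
      - ∑ i, ∑ k, X2 s u i k • φ'' s i k j := fun j => by
    have h := congrFun (hφ s u hs hsu (hut.trans htT)) j
    simp only [Pi.add_apply, Pi.sub_apply, Finset.sum_apply, Pi.smul_apply] at h
    rw [h]
    abel
  have hRφ' : ∀ j k, Rφ' s u j k = φ' u j k - φ' s j k
      - ∑ i, (x u i - x s i) • φ'' s i j k := fun j k => by
    have h := congrFun (congrFun (hφ' s u hs hsu (hut.trans htT)) j) k
    simp only [Pi.add_apply, Pi.sub_apply, Finset.sum_apply, Pi.smul_apply] at h
    rw [h]
    abel
  obtain ⟨hX2, hX3⟩ := hChen s u t hs hsu hut htT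
  have hx : ∀ i, x t i - x s i = (x u i - x s i) + (x t i - x u i) := fun i => by ring
  have swap₁ : ∑ j, ∑ i, ((x u i - x s i) * (x t j - x u j)) • φ' s i j
      = ∑ i, ∑ j, ((x u i - x s i) * (x t j - x u j)) • φ' s i j := Finset.sum_comm
  have swap₂ : ∑ k, ∑ i, ∑ j, (X2 s u i j * (x t k - x u k)) • φ'' s i j k
      = ∑ i, ∑ j, ∑ k, (X2 s u i j * (x t k - x u k)) • φ'' s i j k := by
    rw [Finset.sum_comm]
    exact Finset.sum_congr rfl fun i _ => Finset.sum_comm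
  have swap₃ : ∑ j, ∑ k, ∑ i, ((x u i - x s i) * X2 u t j k) • φ'' s i j k
      = ∑ i, ∑ j, ∑ k, ((x u i - x s i) * X2 u t j k) • φ'' s i j k := by
    rw [Finset.sum_comm (s := Finset.univ (α := Fin d)) (t := Finset.univ (α := Fin d))
      (f := fun i j => ∑ k, ((x u i - x s i) * X2 u t j k) • φ'' s i j k)]
    exact Finset.sum_congr rfl fun j _ => Finset.sum_comm
  simp only [roughXi, hRφ, hRφ', hX2, hX3]
  simp only [hx, add_smul, smul_sub, Finset.smul_sum, smul_smul, Finset.sum_add_distrib,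
    Finset.sum_sub_distrib, mul_comm (x t _ - x u _), mul_comm (X2 u t _ _)]
  rw [swap₁, swap₂, swap₃]
  abel

end
end
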